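/- Fix an integer d ≥ 1. Let n ≥ 2 be an integer and p a prime with p ≡ 1 (mod n). Let U_n = {x ∈ F_p^× : x^n = 1} be the subgroup of order n of F_p^×, and let χ be a multiplicative character of F_p whose restriction to U_n has order n. Let G_d be the set of polynomials f(X) = Σ_{ν=1}^{d} a_ν X^ν with integer coefficients 0 ≤ a_ν ≤ n−1, and for f ∈ G_d ∪ {0} and 1 ≤ i ≤ n define ψ_{f,i} = n^{-1/2} (e_p(f(u)) χ(u)^i)_{u ∈ U_n} ∈ ℂ^{U_n}. Then: (i) for each f ∈ G_d ∪ {0}, the set {ψ_{f,1}, ..., ψ_{f,n}} is an orthonormal basis of ℂ^{U_n}; (ii) for all distinct f, g ∈ G_d ∪ {0} and all 1 ≤ i, j ≤ n: |⟨ψ_{g,j}, ψ_{f,i}⟩| ≤ d p^{1/2} / n. -/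

import Mathlib

open scoped ComplexInnerProductSpace

/-- `e_m(z) = exp(2 π i z / m)` for `z ∈ ZMod m` (represented by an integer in `[0, m-1]`). -/
noncomputable def eZMod (m : ℕ) (z : ZMod m) : ℂ :=
  Complex.exp (2 * Real.pi * Complex.I * (z.val : ℂ) / m)

section

open Polynomial Filter Topology

/-- In `K[x, y] / (y ^ p - y - F x)` give `x` the weight `p` and `y` the weight `deg F`. The
monomial `x ^ a * y ^ b` then has a reduced form, of degree less than `p` in `y`, in which its
weight is attained and not exceeded. -/
theorem exists_reduced_form {K : Type*} [Field K] {p : ℕ} (hp : 2 ≤ p) (F : K[X])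
    (hF : 0 < F.natDegree) (a b : ℕ) :
    ∃ h : K[X][X], (∀ k, p ≤ k → h.coeff k = 0) ∧
      (∀ x z : K, z ^ p = z + F.eval x → h.evalEval x z = x ^ a * z ^ b) ∧
      (∀ k j, (h.coeff k).coeff j ≠ 0 → p * j + F.natDegree * k ≤ p * a + F.natDegree * b) ∧
      ∃ k j, (h.coeff k).coeff j ≠ 0 ∧ p * j + F.natDegree * k = p * a + F.natDegree * b := by
  induction b with
  | zero =>
    refine ⟨C (X ^ a), ?_, ?_, ?_, 0, a, ?_⟩
    · intro k hk
      rw [coeff_C, if_neg (by lia)]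
    · intro x z _
      rw [evalEval_C, eval_pow, eval_X, pow_zero, mul_one]
    · intro k j
      rw [coeff_C]
      split_ifs with hk
      · rw [coeff_X_pow]
        split_ifs with hj
        · simp [hk, hj]
        · simp
      · simp
    · rw [coeff_C_zero, coeff_X_pow_self]
      simp
  | succ b ih =>
    obtain ⟨h, h1, h2, h3, k₀, j₀, h4, h5⟩ := ih
    set D := F.natDegree with hD
    set t := h.coeff (p - 1) with ht
    obtain ⟨m, rfl⟩ : ∃ m, p = m + 2 := ⟨p - 2, by lia⟩
    have c0 : (X * h - C t * (X ^ (m + 2) - X - C F)).coeff 0 = t * F := by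
      simp [mul_sub, coeff_X_pow]
    have c1 : (X * h - C t * (X ^ (m + 2) - X - C F)).coeff 1 = h.coeff 0 + t := by
      have : (X * h).coeff (0 + 1) = h.coeff 0 := coeff_X_mul h 0
      rw [coeff_sub, this, coeff_C_mul, coeff_sub, coeff_sub, coeff_X_pow, coeff_X, coeff_C]
      simp
    have c2 : ∀ k, (X * h - C t * (X ^ (m + 2) - X - C F)).coeff (k + 2)
        = h.coeff (k + 1) - if k = m then t else 0 := by
      intro k
      have : (X * h).coeff ((k + 1) + 1) = h.coeff (k + 1) := coeff_X_mul h (k + 1)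
      rw [coeff_sub, this, coeff_C_mul, coeff_sub, coeff_sub, coeff_X_pow, coeff_X, coeff_C]
      simp
    refine ⟨X * h - C t * (X ^ (m + 2) - X - C F), ?_, ?_, ?_, ?_⟩
    · intro k hk
      obtain ⟨k, rfl⟩ : ∃ k', k = k' + 2 := ⟨k - 2, by lia⟩
      rw [c2]
      split_ifs with hkm
      · rw [hkm, ht]; simp
      · rw [h1 _ (by lia)]; simp
    · intro x z hz
      have := h2 x z hz
      simp only [evalEval_sub, evalEval_mul, evalEval_X, this, evalEval_pow, evalEval_C, hz]
      ring
    · rintro (_ | _ | k) j hj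
      · rw [c0, coeff_mul] at hj
        obtain ⟨⟨i, i'⟩, hi, hne⟩ := Finset.exists_ne_zero_of_sum_ne_zero hj
        rw [Finset.HasAntidiagonal.mem_antidiagonal] at hi
        have hi' : i' ≤ D := le_natDegree_of_ne_zero (right_ne_zero_of_mul hne)
        have := h3 (m + 2 - 1) i (left_ne_zero_of_mul hne)
        simp only [Nat.add_succ_sub_one] at this
        simp only at hi
        subst hi
        nlinarith
      · rw [zero_add, c1, coeff_add] at hj
        by_cases h0 : (h.coeff 0).coeff j = 0
        · have := h3 (m + 2 - 1) j (by rw [h0, zero_add] at hj; exact hj)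
          simp only [Nat.add_succ_sub_one] at this
          nlinarith [Nat.zero_le (D * m)]
        · have := h3 _ _ h0
          nlinarith
      · rw [c2] at hj
        by_cases h0 : (h.coeff (k + 1)).coeff j = 0
        · split_ifs at hj with hkm
          · rw [ht, hkm] at hj
            simp at hj
          · simp [h0] at hj
        · have := h3 _ _ h0
          nlinarith
    · have hk₀ : k₀ < m + 2 := by
        by_contra! hc
        rw [h1 _ hc] at h4
        simp at h4
      rcases Nat.lt_succ_iff_lt_or_eq.1 hk₀ with hlt | heq
      · refine ⟨k₀ + 1, j₀, ?_, by rw [mul_add, mul_add, ← add_assoc, ← add_assoc, h5]⟩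
        rcases k₀ with _ | k₀
        · rw [zero_add, c1, coeff_add]
          have : t.coeff j₀ = 0 := by
            by_contra hc
            have := h3 (m + 2 - 1) j₀ hc
            simp only [Nat.add_succ_sub_one] at this
            nlinarith [Nat.zero_le (D * m)]
          rwa [this, add_zero]
        · rw [c2, if_neg (by lia), sub_zero]
          exact h4
      · refine ⟨0, j₀ + D, ?_, ?_⟩
        · have hdeg : t.natDegree ≤ j₀ := by
            rw [natDegree_le_iff_coeff_eq_zero]
            intro N hN
            by_contra hc
            have := h3 (m + 2 - 1) N hc
            simp only [Nat.add_succ_sub_one] at this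
            subst heq
            nlinarith
          rw [c0, coeff_mul_add_eq_of_natDegree_le hdeg le_rfl]
          refine mul_ne_zero ?_ ?_
          · subst heq
            exact h4
          · exact leadingCoeff_ne_zero.2 (by intro h; rw [hD, h] at hF; simp at hF)
        · subst heq
          linarith

/-- A non-trivial linear combination of polynomials of pairwise distinct weights is non-zero. -/
theorem sum_ne_zero_of_injOn_weight {K ι : Type*} [Field K] (p D : ℕ)
    (s : Finset ι) (h : ι → K[X][X]) (w : ι → ℕ) (hw : Set.InjOn w s)
    (hle : ∀ i ∈ s, ∀ k j, ((h i).coeff k).coeff j ≠ 0 → p * j + D * k ≤ w i)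
    (heq : ∀ i ∈ s, ∃ k j, ((h i).coeff k).coeff j ≠ 0 ∧ p * j + D * k = w i)
    (c : ι → K) (hc : ∃ i ∈ s, c i ≠ 0) : ∑ i ∈ s, C (C (c i)) * h i ≠ 0 := by
  classical
  obtain ⟨i₀, hi₀, hc₀⟩ := hc
  obtain ⟨i, hi, hmax⟩ := Finset.exists_max_image (s.filter fun i => c i ≠ 0) w
    ⟨i₀, Finset.mem_filter.2 ⟨hi₀, hc₀⟩⟩
  rw [Finset.mem_filter] at hi
  obtain ⟨k, j, hne, hkj⟩ := heq i hi.1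
  intro h0
  have h1 : ((∑ i ∈ s, C (C (c i)) * h i).coeff k).coeff j = 0 := by rw [h0]; simp
  rw [finsetSum_coeff, finsetSum_coeff, Finset.sum_eq_single_of_mem i hi.1] at h1
  · simp [hi.2, hne] at h1
  · intro i' hi' hii
    rw [coeff_C_mul, coeff_C_mul]
    by_cases hc' : c i' = 0
    · rw [hc', zero_mul]
    · have h2 := hmax i' (Finset.mem_filter.2 ⟨hi', hc'⟩)
      have h3 : w i' ≠ w i := fun e => hii (hw hi' hi.1 e)
      rw [mul_eq_zero]
      right
      by_contra h4
      have := hle i' hi' k j h4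
      lia

theorem exists_weight_eq {p D : ℕ} (hp : 2 ≤ p) (hD : D.Coprime p) {w : ℕ} (hw : p * D ≤ w) :
    ∃ a b, p * a + D * b = w := by
  have : NeZero p := ⟨by lia⟩
  set u : (ZMod p)ˣ := ZMod.unitOfCoprime D hD
  set b := ((↑u⁻¹ : ZMod p) * w).val with hb
  have hbp : b < p := ZMod.val_lt _
  have hle : D * b ≤ w := by nlinarith
  have hmod : ((D * b : ℕ) : ZMod p) = (w : ℕ) := by
    rw [Nat.cast_mul, hb, ZMod.natCast_zmod_val, ← mul_assoc, ← ZMod.coe_unitOfCoprime D hD,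
      Units.mul_inv, one_mul]
  obtain ⟨a, ha⟩ := (Nat.modEq_iff_dvd' hle).1 ((ZMod.natCast_eq_natCast_iff _ _ _).1 hmod)
  exact ⟨a, b, by lia⟩

/-- The auxiliary function of Stepanov's method for the curve `z ^ p - z = F x`, in the form given
to it by Bombieri: it vanishes at all rational points and its degree is small. -/
theorem exists_auxiliary_polynomial {K : Type*} [Field K] [Fintype K] (p : ℕ) [Fact p.Prime]
    [CharP K p] (s : ℕ) (hK : Fintype.card K = (p ^ s) ^ 2) (F : K[X])
    (hF : F.natDegree.Coprime p) (hP : (p * F.natDegree) ^ 2 + 3 * (p * F.natDegree) + 1 < p ^ s) :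
    ∃ H : K[X][X], H ≠ 0 ∧ (∀ k, p ≤ k → H.coeff k = 0) ∧
      (∀ k, H.coeff k ≠ 0 →
        p * (H.coeff k).natDegree ≤ p ^ s - 1 + p ^ s * (p ^ s + 2 * (p * F.natDegree))) ∧
      ∀ x z : K, z ^ p = z + F.eval x → H.evalEval x z = 0 := by
  classical
  have hp : p.Prime := Fact.out
  set D := F.natDegree with hD
  set P := p ^ s with hPdef
  set g := p * D with hg
  have hD0 : 0 < D := by
    rcases Nat.eq_zero_or_pos D with h | h
    · rw [h, Nat.coprime_zero_left] at hF
      exact absurd hF hp.one_lt.ne'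
    · exact h
  choose N hN1 hN2 hN3 hN4 using fun a b => exists_reduced_form hp.two_le F hD0 a b
  have hab : ∀ w, ∃ ab : ℕ × ℕ, g ≤ w → p * ab.1 + D * ab.2 = w := by
    intro w
    by_cases hw : g ≤ w
    · obtain ⟨a, b, h⟩ := exists_weight_eq hp.two_le hF hw
      exact ⟨(a, b), fun _ => h⟩
    · exact ⟨(0, 0), fun h => absurd h hw⟩
  choose e he using hab
  set l := P - 1 with hl
  set m := P + 2 * g with hm
  set I := Finset.Icc g l ×ˢ Finset.Icc g m with hI
  set T := ((Finset.range p) ×ˢ (Finset.range (P * l + m + 1))).filter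
    (fun kj => p * kj.2 + D * kj.1 ≤ P * l + m) with hT
  have hTinj : Set.InjOn (fun kj : ℕ × ℕ => p * kj.2 + D * kj.1) T := by
    rintro ⟨k, j⟩ h1 ⟨k', j'⟩ h2 h
    simp only [hT, Finset.coe_filter, Finset.mem_product, Finset.mem_range, Set.mem_ofPred_eq]
      at h1 h2 h
    have hk : k = k' := by
      have : D * k ≡ D * k' [MOD p] := by
        have h3 : (p * j + D * k) % p = (p * j' + D * k') % p := by rw [h]
        simpa [Nat.add_mod, Nat.ModEq] using h3
      have := Nat.ModEq.cancel_left_of_coprime (by rwa [Nat.coprime_comm] at hF) this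
      exact Nat.ModEq.eq_of_lt_of_lt this h1.1.1 h2.1.1
    subst hk
    have : p * j = p * j' := by lia
    rw [Nat.mul_left_cancel hp.pos this]
  have hTcard : T.card ≤ P * l + m + 1 := by
    have := Finset.card_le_card_of_injOn (t := Finset.range (P * l + m + 1)) _ ?_ hTinj
    · rwa [Finset.card_range] at this
    · rintro ⟨k, j⟩ h
      simp only [hT, Finset.coe_filter, Set.mem_ofPred_eq] at h
      simp only [Finset.coe_range, Set.mem_Iio]
      lia
  have hcard : T.card < I.card := by
    refine hTcard.trans_lt ?_
    rw [hI, Finset.card_product, Nat.card_Icc, Nat.card_Icc]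
    have hgP : g < P := by nlinarith
    obtain ⟨u, hu⟩ : ∃ u, P = g + u := ⟨P - g, by lia⟩
    have e1 : l + 1 - g = u := by lia
    have e2 : m + 1 - g = 2 * g + u + 1 := by lia
    have e3 : l = g + u - 1 := by lia
    have e4 : m = 3 * g + u := by lia
    obtain ⟨v, hv⟩ : ∃ v, g + u = v + 1 := ⟨g + u - 1, by lia⟩
    rw [e1, e2, e3, e4, hu]
    have e5 : g + u - 1 = v := by lia
    rw [e5]
    have e6 : (g + u) * v + (g + u) = (g + u) * (g + u) := by rw [hv]; ring
    nlinarith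
  obtain ⟨c, hc0, hc⟩ : ∃ c : I → K, c ≠ 0 ∧
      (Matrix.of fun (t : T) (i : I) => ((N (P * (e i.1.1).1 + (e i.1.2).1)
        (P * (e i.1.1).2 + (e i.1.2).2)).coeff t.1.1).coeff t.1.2).mulVec c = 0 := by
    have := LinearMap.ker_ne_bot_of_finrank_lt (f := Matrix.mulVecLin
      (Matrix.of fun (t : T) (i : I) => ((N (P * (e i.1.1).1 + (e i.1.2).1)
        (P * (e i.1.1).2 + (e i.1.2).2)).coeff t.1.1).coeff t.1.2)) (by simpa using hcard)
    obtain ⟨c, hc, hc0⟩ := Submodule.exists_mem_ne_zero_of_ne_bot this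
    exact ⟨c, hc0, hc⟩
  have hIw : ∀ i ∈ I, g ≤ i.1 ∧ i.1 ≤ l ∧ g ≤ i.2 ∧ i.2 ≤ m := by
    intro i hi
    rw [hI, Finset.mem_product, Finset.mem_Icc, Finset.mem_Icc] at hi
    exact ⟨hi.1.1, hi.1.2, hi.2.1, hi.2.2⟩
  have hG : ∑ i : I, C (C (c i)) * N (P * (e i.1.1).1 + (e i.1.2).1)
      (P * (e i.1.1).2 + (e i.1.2).2) = 0 := by
    ext k j
    rw [finsetSum_coeff, finsetSum_coeff, coeff_zero, coeff_zero]
    simp only [coeff_C_mul]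
    by_cases hkj : (k, j) ∈ T
    · have := congrFun hc ⟨(k, j), hkj⟩
      simp only [Matrix.mulVec, dotProduct, Matrix.of_apply, Pi.zero_apply] at this
      rw [← this]
      exact Finset.sum_congr rfl fun i _ => mul_comm _ _
    · refine Finset.sum_eq_zero fun i _ => ?_
      rw [mul_eq_zero]
      right
      by_contra hne
      apply hkj
      have h1 := hN3 _ _ _ _ hne
      have h2 : k < p := by
        by_contra! hc
        rw [hN1 _ _ _ hc] at hne
        simp at hne
      obtain ⟨i1, i2, i3, i4⟩ := hIw i.1 i.2
      have h3 := he _ i1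
      have h4 := he _ i3
      have h5 : p * j + D * k ≤ P * l + m := by
        calc p * j + D * k ≤ _ := h1
          _ = P * (p * (e i.1.1).1 + D * (e i.1.1).2) + (p * (e i.1.2).1 + D * (e i.1.2).2) := by
            ring
          _ ≤ _ := by rw [h3, h4]; gcongr
      simp only [hT, Finset.mem_filter, Finset.mem_product, Finset.mem_range]
      refine ⟨⟨h2, ?_⟩, h5⟩
      nlinarith [hp.two_le]
  set H := ∑ i : I, C (C (c i ^ P)) * N ((e i.1.1).1 + P * (e i.1.2).1)
      ((e i.1.1).2 + P * (e i.1.2).2) with hH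
  have hweight : ∀ i : I, p * ((e i.1.1).1 + P * (e i.1.2).1) + D * ((e i.1.1).2 + P * (e i.1.2).2)
      = i.1.1 + P * i.1.2 := by
    intro i
    obtain ⟨i1, i2, i3, i4⟩ := hIw i.1 i.2
    have h3 := he _ i1
    have h4 := he _ i3
    calc _ = (p * (e i.1.1).1 + D * (e i.1.1).2) + P * (p * (e i.1.2).1 + D * (e i.1.2).2) := by
            ring
      _ = _ := by rw [h3, h4]
  have hP0 : 0 < P := pow_pos hp.pos s
  have hH0 : H ≠ 0 := by
    refine sum_ne_zero_of_injOn_weight p D Finset.univ _ (fun i : I => i.1.1 + P * i.1.2)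
      ?_ ?_ ?_ (fun i => c i ^ P) ?_
    · rintro i - i' - h
      obtain ⟨i1, i2, i3, i4⟩ := hIw i.1 i.2
      obtain ⟨j1, j2, j3, j4⟩ := hIw i'.1 i'.2
      simp only at h
      have a1 : i.1.1 < P := by lia
      have a2 : i'.1.1 < P := by lia
      have h1 : i.1.1 = i'.1.1 := by
        have h3 : (i.1.1 + P * i.1.2) % P = (i'.1.1 + P * i'.1.2) % P := by rw [h]
        simpa [Nat.add_mod, Nat.mod_eq_of_lt, a1, a2] using h3
      have h2 : P * i.1.2 = P * i'.1.2 := by lia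
      exact Subtype.ext (Prod.ext h1 (Nat.mul_left_cancel hP0 h2))
    · intro i _ k j hkj
      rw [← hweight i]
      exact hN3 _ _ _ _ hkj
    · intro i _
      rw [← hweight i]
      exact hN4 _ _
    · obtain ⟨i, hi⟩ := Function.ne_iff.1 hc0
      exact ⟨i, Finset.mem_univ i, pow_ne_zero _ hi⟩
  have hfrob : ∀ x : K, (x ^ P) ^ P = x := by
    intro x
    rw [← pow_mul, ← sq, ← hK, FiniteField.pow_card]
  have heval : ∀ x z : K, z ^ p = z + F.eval x → H.evalEval x z = 0 := by
    intro x z hz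
    have h1 : (∑ i : I, c i * (x ^ (P * (e i.1.1).1 + (e i.1.2).1) *
        z ^ (P * (e i.1.1).2 + (e i.1.2).2))) = 0 := by
      have := congrArg (evalEval x z) hG
      rw [evalEval_finsetSum, evalEval_zero] at this
      rw [← this]
      refine Finset.sum_congr rfl fun i _ => ?_
      rw [evalEval_mul, hN2 _ _ _ _ hz, evalEval_C, eval_C]
    have h2 := congrArg (fun y => y ^ P) h1
    simp only [hPdef] at h2
    rw [sum_pow_char_pow, zero_pow hP0.ne'] at h2
    rw [hH, evalEval_finsetSum, ← h2]
    refine Finset.sum_congr rfl fun i _ => ?_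
    rw [evalEval_mul, hN2 _ _ _ _ hz, evalEval_C, eval_C, ← hPdef]
    have e1 : ∀ (y : K) (a b : ℕ), (y ^ (P * a + b)) ^ P = y ^ (a + P * b) := by
      intro y a b
      rw [pow_add, mul_pow, pow_mul, pow_right_comm, hfrob, pow_add, ← pow_mul, mul_comm b P]
    rw [mul_pow, mul_pow, e1, e1]
  refine ⟨H, hH0, ?_, ?_, heval⟩
  · intro k hk
    rw [hH, finsetSum_coeff]
    refine Finset.sum_eq_zero fun i _ => ?_
    rw [coeff_C_mul, hN1 _ _ _ hk, mul_zero]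
  · intro k hk
    have h1 : (H.coeff k).coeff (H.coeff k).natDegree ≠ 0 := leadingCoeff_ne_zero.2 hk
    generalize (H.coeff k).natDegree = n at h1 ⊢
    rw [hH, finsetSum_coeff, finsetSum_coeff] at h1
    obtain ⟨i, _, hi⟩ := Finset.exists_ne_zero_of_sum_ne_zero h1
    rw [coeff_C_mul, coeff_C_mul] at hi
    have h2 := hN3 _ _ _ _ (right_ne_zero_of_mul hi)
    rw [hweight i] at h2
    obtain ⟨i1, i2, i3, i4⟩ := hIw i.1 i.2
    calc p * n ≤ p * n + D * k := Nat.le_add_right _ _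
      _ ≤ i.1.1 + P * i.1.2 := h2
      _ ≤ l + P * m := by gcongr

/-- Stepanov's bound for the number of fibres of `z ^ p - z = F x` that consist of rational
points. -/
theorem card_mul_le_of_artinSchreier {K : Type*} [Field K] [Fintype K] (p : ℕ) [Fact p.Prime]
    [CharP K p] (s : ℕ) (hK : Fintype.card K = (p ^ s) ^ 2) (F : K[X])
    (hF : F.natDegree.Coprime p) (hP : (p * F.natDegree) ^ 2 + 3 * (p * F.natDegree) + 1 < p ^ s)
    (A : Finset K) (hA : ∀ x ∈ A, ∃ z : K, z ^ p = z + F.eval x) :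
    p * A.card ≤ (p ^ s) ^ 2 + (2 * (p * F.natDegree) + 1) * p ^ s := by
  obtain ⟨H, hH0, hHdeg, hHw, heval⟩ := exists_auxiliary_polynomial p s hK F hF hP
  obtain ⟨k, hk⟩ : ∃ k, H.coeff k ≠ 0 := by
    by_contra! h
    exact hH0 (ext h)
  have hAroot : ∀ x ∈ A, (H.coeff k).IsRoot x := by
    intro x hx
    obtain ⟨z, hz⟩ := hA x hx
    have hmap : H.map (evalRingHom x) = 0 := by
      let := ZMod.algebra K p
      have hinj : Function.Injective fun t : ZMod p => z + algebraMap (ZMod p) K t :=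
        fun t t' h => (algebraMap (ZMod p) K).injective (add_left_cancel h)
      refine eq_zero_of_natDegree_lt_card_of_eval_eq_zero _ hinj ?_ ?_
      · intro t
        rw [map_evalRingHom_eval]
        apply heval
        rw [add_pow_char, ← map_pow, ZMod.pow_card, hz]
        ring
      · rw [ZMod.card]
        have : H.natDegree < p := by
          rw [natDegree_lt_iff_degree_lt hH0, degree_lt_iff_coeff_zero]
          exact hHdeg
        exact natDegree_map_le.trans_lt this
    have := congrArg (fun q => coeff q k) hmap
    simpa [coeff_map] using this
  have hAcard : A.card ≤ (H.coeff k).natDegree :=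
    card_le_degree_of_subset_roots fun x hx => (mem_roots hk).2 (hAroot x hx)
  calc p * A.card ≤ p ^ s - 1 + p ^ s * (p ^ s + 2 * (p * F.natDegree)) :=
        (Nat.mul_le_mul_left p hAcard).trans (hHw k hk)
    _ ≤ p ^ s + p ^ s * (p ^ s + 2 * (p * F.natDegree)) := by gcongr; lia
    _ = _ := by ring

theorem norm_sum_addChar_eval_le {K : Type*} [Field K] [Fintype K] (p : ℕ) [Fact p.Prime]
    [CharP K p] (s : ℕ) (hK : Fintype.card K = (p ^ s) ^ 2) (Ψ : AddChar K ℂ) (hΨ : Ψ ≠ 1)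
    (hΨp : ∀ z, Ψ (z ^ p) = Ψ z) (F : K[X]) (hF : F.natDegree.Coprime p)
    (hP : (p * F.natDegree) ^ 2 + 3 * (p * F.natDegree) + 1 < p ^ s) :
    ‖∑ x, Ψ (F.eval x)‖ ≤ (2 * (p * F.natDegree) + 1) * p ^ s := by
  classical
  have hp : p.Prime := Fact.out
  set S := ∑ x, Ψ (F.eval x) with hS
  set V : ℝ := (p ^ s) ^ 2 + (2 * (p * F.natDegree) + 1) * p ^ s with hV
  set M : K → ℝ := fun β => ∑ x, ∑ z : K, if F.eval x - (z ^ p - z) = β then 1 else 0 with hM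
  have hMle : ∀ β, M β ≤ V := by
    intro β
    set A := Finset.univ.filter fun x : K => ∃ z : K, F.eval x - (z ^ p - z) = β with hA
    have h1 : ∀ x, (∑ z : K, if F.eval x - (z ^ p - z) = β then (1 : ℝ) else 0) ≤
        if x ∈ A then (p : ℝ) else 0 := by
      intro x
      split_ifs with hx
      · rw [Finset.sum_boole]
        set q : K[X] := X ^ p - X - C (F.eval x - β) with hq
        have hXq : (X + C (F.eval x - β)).natDegree < (X ^ p : K[X]).natDegree := by
          rw [natDegree_X_add_C, natDegree_X_pow]
          exact hp.one_lt
        have hq' : q = X ^ p - (X + C (F.eval x - β)) := by rw [hq]; ring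
        have hqdeg : q.natDegree = p := by
          rw [hq', natDegree_sub_eq_left_of_natDegree_lt hXq, natDegree_X_pow]
        have hq0 : q ≠ 0 := by
          intro h
          rw [h, natDegree_zero] at hqdeg
          exact hp.ne_zero hqdeg.symm
        have h2 := card_le_degree_of_subset_roots (p := q)
          (Z := Finset.univ.filter fun z : K => F.eval x - (z ^ p - z) = β) (by
            intro z hz
            rw [Finset.mem_val, Finset.mem_filter] at hz
            rw [mem_roots hq0, IsRoot.def, hq]
            simp only [eval_sub, eval_pow, eval_X, eval_C]
            rw [← hz.2]
            ring)
        rw [hqdeg] at h2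
        exact_mod_cast h2
      · refine (Finset.sum_eq_zero fun z _ => ?_).le
        rw [if_neg]
        exact fun h => hx (Finset.mem_filter.2 ⟨Finset.mem_univ _, z, h⟩)
    have h3 := card_mul_le_of_artinSchreier p s hK (F - C β) (by rwa [natDegree_sub_C])
      (by rwa [natDegree_sub_C]) A (by
        intro x hx
        obtain ⟨z, hz⟩ := (Finset.mem_filter.1 hx).2
        refine ⟨z, ?_⟩
        rw [eval_sub, eval_C, ← hz]
        ring)
    rw [natDegree_sub_C] at h3
    calc M β ≤ ∑ x, if x ∈ A then (p : ℝ) else 0 := Finset.sum_le_sum fun x _ => h1 x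
      _ = ((p * A.card : ℕ) : ℝ) := by
        rw [Finset.sum_ite_mem, Finset.univ_inter, Finset.sum_const, nsmul_eq_mul]
        push_cast
        ring
      _ ≤ V := by
        rw [hV]
        exact_mod_cast h3
  have hMsum : ∑ β, M β = (Fintype.card K : ℝ) ^ 2 := by
    simp only [hM]
    rw [Finset.sum_comm]
    simp_rw [Finset.sum_comm (s := (Finset.univ : Finset K)) (t := (Finset.univ : Finset K))
      (f := fun y z => if _ = y then (1 : ℝ) else 0)]
    simp [sq]
  have hMS : (Fintype.card K : ℂ) * S = ∑ β, Ψ β * ((M β : ℝ) : ℂ) := by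
    have h1 : ∀ β, Ψ β * ((M β : ℝ) : ℂ) =
        ∑ x, ∑ z : K, if F.eval x - (z ^ p - z) = β then Ψ β else 0 := by
      intro β
      simp only [hM]
      push_cast
      simp_rw [Finset.mul_sum]
      refine Finset.sum_congr rfl fun x _ => Finset.sum_congr rfl fun z _ => ?_
      split_ifs <;> simp
    simp_rw [h1]
    rw [Finset.sum_comm, hS, Finset.mul_sum]
    refine Finset.sum_congr rfl fun x _ => ?_
    rw [Finset.sum_comm]
    have h2 : ∀ z : K, Ψ (F.eval x - (z ^ p - z)) = Ψ (F.eval x) := by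
      intro z
      rw [sub_sub_eq_add_sub, AddChar.map_sub_eq_div, AddChar.map_add_eq_mul, hΨp,
        mul_div_cancel_right₀]
      intro h
      have := AddChar.norm_apply Ψ z
      rw [h] at this
      simp at this
    simp [h2]
  have hQ : (0 : ℝ) < Fintype.card K := by exact_mod_cast Fintype.card_pos
  have hQ2 : (Fintype.card K : ℝ) = (p ^ s) ^ 2 := by exact_mod_cast hK
  have hmain : (Fintype.card K : ℝ) * ‖S‖ ≤ Fintype.card K * (V - Fintype.card K) := by
    calc (Fintype.card K : ℝ) * ‖S‖ = ‖(Fintype.card K : ℂ) * S‖ := by simp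
      _ = ‖∑ β, Ψ β * (((M β - V : ℝ)) : ℂ)‖ := by
        rw [hMS]
        push_cast
        simp_rw [mul_sub]
        rw [Finset.sum_sub_distrib, ← Finset.sum_mul, AddChar.sum_eq_zero_of_ne_one hΨ, zero_mul,
          sub_zero]
      _ ≤ ∑ β, (V - M β) := by
        refine norm_sum_le_of_le _ fun β _ => ?_
        rw [norm_mul, AddChar.norm_apply, one_mul, Complex.norm_real, Real.norm_eq_abs,
          abs_of_nonpos (by linarith [hMle β])]
        linarith
      _ = _ := by
        rw [Finset.sum_sub_distrib, hMsum, Finset.sum_const, Finset.card_univ, nsmul_eq_mul]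
        ring
  have := le_of_mul_le_mul_left hmain hQ
  rw [hQ2, hV] at this
  linarith

theorem norm_sum_mul_addChar_eval_le {K : Type*} [Field K] [Fintype K] (p : ℕ) [Fact p.Prime]
    [CharP K p] (s : ℕ) (hK : Fintype.card K = (p ^ s) ^ 2) (Ψ : AddChar K ℂ) (hΨ : Ψ ≠ 1)
    (hΨp : ∀ z, Ψ (z ^ p) = Ψ z) (η : K →* ℂ) (hη0 : η 0 = 0)
    (hη : ∀ y, y ≠ 0 → η y ^ (p - 1) = 1) (f : K[X]) (hf : f.natDegree.Coprime p)
    (hP : (p * (f.natDegree * (p - 1))) ^ 2 + 3 * (p * (f.natDegree * (p - 1))) + 1 < p ^ s) :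
    ‖∑ x, η x * Ψ (f.eval x)‖ ≤ (2 * (p * (f.natDegree * (p - 1) : ℕ)) + 2) * p ^ s := by
  classical
  have hp : p.Prime := Fact.out
  set E := f.natDegree * (p - 1) with hE
  set S := ∑ x, η x * Ψ (f.eval x) with hS
  set U := Finset.univ.filter fun y : K => y ≠ 0 with hU
  have hEp : E.Coprime p := by
    refine Nat.Coprime.mul_left hf ?_
    have := Nat.coprime_self_sub_left (m := 1) (n := p) hp.one_lt.le
    rw [this]
    exact Nat.coprime_one_left p
  have hinner : ∀ g ∈ U, ‖∑ y ∈ U, Ψ (f.eval (g * y ^ (p - 1)))‖ ≤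
      (2 * (p * E) + 2) * (p : ℝ) ^ s := by
    intro g hg
    have hg0 : g ≠ 0 := (Finset.mem_filter.1 hg).2
    have hdeg : (f.comp (C g * X ^ (p - 1))).natDegree = E := by
      rw [natDegree_comp, natDegree_C_mul_X_pow _ _ hg0]
    have h1 := norm_sum_addChar_eval_le p s hK Ψ hΨ hΨp (f.comp (C g * X ^ (p - 1)))
      (by rwa [hdeg]) (by rwa [hdeg])
    rw [hdeg] at h1
    have h2 : ∑ y ∈ U, Ψ (f.eval (g * y ^ (p - 1))) =
        ∑ y, Ψ ((f.comp (C g * X ^ (p - 1))).eval y) - Ψ (f.eval (g * 0 ^ (p - 1))) := by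
      rw [hU, Finset.filter_ne', ← Finset.sum_erase_add _ _ (Finset.mem_univ (0 : K))]
      simp [eval_comp]
    have h3 : (1 : ℝ) ≤ p ^ s := one_le_pow₀ (by exact_mod_cast hp.one_lt.le)
    rw [h2]
    refine (norm_sub_le _ _).trans ?_
    rw [AddChar.norm_apply]
    linarith
  have hηnorm : ∀ g ∈ U, ‖η g‖ = 1 := by
    intro g hg
    exact Complex.norm_eq_one_of_pow_eq_one (hη g (Finset.mem_filter.1 hg).2)
      (by have := hp.two_le; lia)
  have hSU : S = ∑ x ∈ U, η x * Ψ (f.eval x) := by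
    rw [hU, Finset.sum_filter, hS]
    refine Finset.sum_congr rfl fun x _ => ?_
    split_ifs with h
    · rfl
    · rw [not_not] at h
      rw [h, hη0, zero_mul]
  have hUpos : (0 : ℝ) < U.card := by
    have : 0 < U.card := Finset.card_pos.2 ⟨1, by simp [hU]⟩
    exact_mod_cast this
  have hsum : (U.card : ℂ) * S = ∑ g ∈ U, η g * ∑ y ∈ U, Ψ (f.eval (g * y ^ (p - 1))) := by
    simp_rw [Finset.mul_sum]
    rw [Finset.sum_comm, ← nsmul_eq_mul, ← Finset.sum_const]
    refine Finset.sum_congr rfl fun y hy => ?_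
    have hy0 : y ≠ 0 := (Finset.mem_filter.1 hy).2
    rw [hSU]
    symm
    refine Finset.sum_bij' (fun g _ => g * y ^ (p - 1)) (fun x _ => x * (y ^ (p - 1))⁻¹)
      ?_ ?_ ?_ ?_ ?_
    · intro g hg
      simp only [hU, Finset.mem_filter, Finset.mem_univ, true_and] at hg ⊢
      exact mul_ne_zero hg (pow_ne_zero _ hy0)
    · intro g hg
      simp only [hU, Finset.mem_filter, Finset.mem_univ, true_and] at hg ⊢
      exact mul_ne_zero hg (inv_ne_zero (pow_ne_zero _ hy0))
    · intro g _
      exact mul_inv_cancel_right₀ (pow_ne_zero _ hy0) g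
    · intro g _
      exact inv_mul_cancel_right₀ (pow_ne_zero _ hy0) g
    · intro g _
      rw [map_mul, map_pow, hη y hy0, mul_one]
  have hmain : (U.card : ℝ) * ‖S‖ ≤ U.card * ((2 * (p * E) + 2) * (p : ℝ) ^ s) := by
    calc (U.card : ℝ) * ‖S‖ = ‖(U.card : ℂ) * S‖ := by simp
      _ ≤ ∑ g ∈ U, (2 * (p * E) + 2) * (p : ℝ) ^ s := by
        rw [hsum]
        refine norm_sum_le_of_le _ fun g hg => ?_
        rw [norm_mul, hηnorm g hg, one_mul]
        exact hinner g hg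
      _ = _ := by rw [Finset.sum_const, nsmul_eq_mul]
  exact le_of_mul_le_mul_left hmain hUpos

/-- The generating series `∑_{j ≥ 1} p_j T ^ j` of the power sums of the roots of a monic
polynomial, written as minus the logarithmic derivative of the reversed polynomial. -/
noncomputable def powerSumSeries {k : Type*} [Field k] (g : k[X]) : PowerSeries k :=
  -(PowerSeries.X * PowerSeries.derivative k (g.reverse : PowerSeries k)) *
    (g.reverse : PowerSeries k)⁻¹

theorem constantCoeff_reverse_of_monic {k : Type*} [Field k] {g : k[X]} (hg : g.Monic) :
    PowerSeries.constantCoeff (g.reverse : PowerSeries k) = 1 := by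
  rw [← PowerSeries.coeff_zero_eq_constantCoeff_apply, Polynomial.coeff_coe, coeff_zero_reverse]
  exact hg

theorem powerSumSeries_eq_iff {k : Type*} [Field k] {g : k[X]} (hg : g.Monic)
    {A : PowerSeries k} :
    A = powerSumSeries g ↔ A * (g.reverse : PowerSeries k) =
      -(PowerSeries.X * PowerSeries.derivative k (g.reverse : PowerSeries k)) :=
  PowerSeries.eq_mul_inv_iff_mul_eq (by rw [constantCoeff_reverse_of_monic hg]; exact one_ne_zero)

theorem powerSumSeries_mul {k : Type*} [Field k] {g h : k[X]} (hg : g.Monic) (hh : h.Monic) :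
    powerSumSeries (g * h) = powerSumSeries g + powerSumSeries h := by
  symm
  rw [powerSumSeries_eq_iff (hg.mul hh), reverse_mul_of_domain, Polynomial.coe_mul,
    Derivation.leibniz]
  have h1 := (powerSumSeries_eq_iff hg).1 rfl
  have h2 := (powerSumSeries_eq_iff hh).1 rfl
  simp only [smul_eq_mul]
  linear_combination (h.reverse : PowerSeries k) * h1 + (g.reverse : PowerSeries k) * h2

theorem powerSumSeries_one {k : Type*} [Field k] : powerSumSeries (1 : k[X]) = 0 := by
  have h : (1 : k[X]).reverse = 1 := by rw [← C_1, reverse_C]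
  simp [powerSumSeries, h]

theorem coeff_powerSumSeries_map {k L : Type*} [Field k] [Field L] (φ : k →+* L) {g : k[X]}
    (hg : g.Monic) (j : ℕ) :
    PowerSeries.coeff j (powerSumSeries (g.map φ)) =
      φ (PowerSeries.coeff j (powerSumSeries g)) := by
  have hrev : ((g.map φ).reverse : PowerSeries L) =
      PowerSeries.map φ (g.reverse : PowerSeries k) := by
    rw [reverse, natDegree_map, reflect_map, polynomial_map_coe]
    rfl
  have : PowerSeries.map φ (powerSumSeries g) = powerSumSeries (g.map φ) := by
    rw [powerSumSeries_eq_iff (hg.map φ), hrev, ← map_mul, (powerSumSeries_eq_iff hg).1 rfl]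
    ext n
    rcases n with _ | n
    · simp
    · simp [PowerSeries.coeff_succ_X_mul, PowerSeries.coeff_derivative]
  rw [← this, PowerSeries.coeff_map]

theorem coeff_powerSumSeries_X_sub_C {k : Type*} [Field k] (a : k) {j : ℕ} (hj : j ≠ 0) :
    PowerSeries.coeff j (powerSumSeries (X - C a)) = a ^ j := by
  have hrev : ((X - C a : k[X]).reverse : PowerSeries k) = 1 - PowerSeries.C a * PowerSeries.X := by
    have : (X - C a : k[X]).reverse = 1 - C a * X := by
      have h1 : reflect 1 (X : k[X]) = 1 := by
        simpa using reflect_monomial (R := k) 1 1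
      rw [reverse, natDegree_X_sub_C, reflect_sub, reflect_C, h1, pow_one]
    rw [this]
    simp
  have : PowerSeries.mk (fun j => if j = 0 then 0 else a ^ j) = powerSumSeries (X - C a) := by
    rw [powerSumSeries_eq_iff (monic_X_sub_C a), hrev]
    ext n
    rcases n with _ | n
    · simp
    · have e1 : PowerSeries.mk (fun j => if j = 0 then 0 else a ^ j) *
          (1 - PowerSeries.C a * PowerSeries.X) =
          PowerSeries.mk (fun j => if j = 0 then 0 else a ^ j) -
          PowerSeries.C a * (PowerSeries.mk (fun j => if j = 0 then 0 else a ^ j) *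
            PowerSeries.X) := by ring
      rw [e1, map_sub, PowerSeries.coeff_C_mul, PowerSeries.coeff_succ_mul_X, map_neg,
        PowerSeries.coeff_succ_X_mul, PowerSeries.coeff_derivative]
      rcases n with _ | n
      · simp
      · simp [pow_succ, PowerSeries.coeff_one]
        ring
  rw [← this, PowerSeries.coeff_mk, if_neg hj]

theorem coeff_powerSumSeries_prod {k : Type*} [Field k] (s : Multiset k) {j : ℕ} (hj : j ≠ 0) :
    PowerSeries.coeff j (powerSumSeries (s.map fun a => X - C a).prod) =
      (s.map fun a => a ^ j).sum := by
  induction s using Multiset.induction with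
  | empty => simp [powerSumSeries_one]
  | cons a s ih =>
    rw [Multiset.map_cons, Multiset.prod_cons, powerSumSeries_mul (monic_X_sub_C a)
      (monic_multiset_prod_of_monic _ _ fun a _ => monic_X_sub_C a), map_add,
      coeff_powerSumSeries_X_sub_C a hj, ih, Multiset.map_cons, Multiset.sum_cons]

/-- Newton's identities, differentiated: changing the coefficient of `X ^ (m - d)` does not affect
the first `d - 1` power sums of the roots, and the `d`-th one changes linearly. -/
theorem coeff_powerSumSeries_add {k : Type*} [Field k] {g : k[X]} (hg : g.Monic) {d : ℕ}
    (hd : 0 < d) (hdg : d ≤ g.natDegree) (c : k) {j : ℕ} (hj : j ≤ d) :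
    PowerSeries.coeff j (powerSumSeries (g + C c * X ^ (g.natDegree - d))) =
      PowerSeries.coeff j (powerSumSeries g) - if j = d then d * c else 0 := by
  have hlt : (C c * X ^ (g.natDegree - d)).degree < g.degree := by
    refine (degree_C_mul_X_pow_le _ _).trans_lt ?_
    rw [degree_eq_natDegree hg.ne_zero]
    exact_mod_cast Nat.sub_lt_of_pos_le hd hdg
  have hm : (g + C c * X ^ (g.natDegree - d)).Monic := hg.add_of_left hlt
  have hdeg : (g + C c * X ^ (g.natDegree - d)).natDegree = g.natDegree :=
    natDegree_eq_of_degree_eq (degree_add_eq_left_of_degree_lt hlt)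
  have hrev : ((g + C c * X ^ (g.natDegree - d)).reverse : PowerSeries k) =
      (g.reverse : PowerSeries k) + PowerSeries.C c * PowerSeries.X ^ d := by
    have : (g + C c * X ^ (g.natDegree - d)).reverse = g.reverse + C c * X ^ d := by
      rw [reverse, hdeg, reflect_add, reflect_C_mul_X_pow, revAt_le (Nat.sub_le _ _),
        Nat.sub_sub_self hdg]
      rfl
    rw [this]
    simp
  set G : PowerSeries k := (g.reverse : PowerSeries k) with hG
  set A := powerSumSeries g
  set B := powerSumSeries (g + C c * X ^ (g.natDegree - d)) with hB
  have h1 : A * G = _ := (powerSumSeries_eq_iff hg).1 rfl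
  have h2 := (powerSumSeries_eq_iff hm).1 hB
  rw [hrev, map_add, Derivation.leibniz, PowerSeries.derivative_C, Derivation.leibniz_pow,
    PowerSeries.derivative_X] at h2
  have hG1 : PowerSeries.constantCoeff G ≠ 0 := by
    rw [hG, constantCoeff_reverse_of_monic hg]
    exact one_ne_zero
  have hB0 : PowerSeries.constantCoeff B = 0 := by
    rw [hB, powerSumSeries]
    simp
  have hX : (PowerSeries.X : PowerSeries k) * PowerSeries.X ^ (d - 1) = PowerSeries.X ^ d := by
    rw [← pow_succ', Nat.sub_add_cancel hd]
  have h3 : B = A + PowerSeries.X ^ d *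
      (-((d : PowerSeries k) * PowerSeries.C c + B * PowerSeries.C c) * G⁻¹) := by
    rw [← mul_assoc, ← sub_eq_iff_eq_add', PowerSeries.eq_mul_inv_iff_mul_eq hG1, sub_mul, h1]
    simp only [smul_eq_mul, nsmul_eq_mul, mul_zero, add_zero, mul_one] at h2
    linear_combination h2 - (d : PowerSeries k) * PowerSeries.C c * hX
  rw [h3, map_add, PowerSeries.coeff_X_pow_mul']
  rcases hj.lt_or_eq with h | h
  · rw [if_neg (by lia), if_neg h.ne, sub_zero, add_zero]
  · subst h
    rw [if_pos le_rfl, if_pos rfl, Nat.sub_self, PowerSeries.coeff_zero_eq_constantCoeff_apply,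
      map_mul, PowerSeries.constantCoeff_inv, hG, constantCoeff_reverse_of_monic hg]
    simp [hB0]
    ring

/-- The monic polynomials of degree `m` over a finite field. -/
noncomputable def monicOfDegree (k : Type*) [Field k] [Finite k] (m : ℕ) : Finset k[X] := by
  classical
  exact (Set.finite_range fun a : Fin m → k =>
    X ^ m + ((degreeLTEquiv k m).symm a : k[X])).toFinset

theorem mem_monicOfDegree {k : Type*} [Field k] [Finite k] {m : ℕ} {g : k[X]} :
    g ∈ monicOfDegree k m ↔ g.Monic ∧ g.natDegree = m := by
  rw [monicOfDegree, Set.Finite.mem_toFinset, Set.mem_range]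
  constructor
  · rintro ⟨a, rfl⟩
    have h := mem_degreeLT.1 ((degreeLTEquiv k m).symm a).2
    refine ⟨monic_X_pow_add h, natDegree_eq_of_degree_eq_some ?_⟩
    rw [degree_add_eq_left_of_degree_lt (by rwa [degree_X_pow]), degree_X_pow]
  · rintro ⟨hg, rfl⟩
    have h : g - X ^ g.natDegree ∈ degreeLT k g.natDegree := by
      rw [mem_degreeLT, ← degree_eq_natDegree hg.ne_zero]
      refine degree_sub_lt_left ?_ hg.ne_zero ?_
      · rw [degree_X_pow, degree_eq_natDegree hg.ne_zero]
      · rw [hg.leadingCoeff, leadingCoeff_X_pow]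
    refine ⟨degreeLTEquiv k _ ⟨_, h⟩, ?_⟩
    rw [LinearEquiv.symm_apply_apply]
    ring

open Classical in
theorem natDegree_eq_sum_irreducible {k : Type*} [Field k] [Finite k] {g : k[X]}
    (hg : g.Monic) :
    g.natDegree = ∑ e ∈ Finset.Icc 1 g.natDegree,
      ∑ q ∈ (monicOfDegree k e).filter Irreducible,
        ∑ l ∈ Finset.Icc 1 g.natDegree, if q ^ l ∣ g then e else 0 := by
  set s := UniqueFactorizationMonoid.normalizedFactors g with hs
  have hirr : ∀ q ∈ s, Irreducible q := fun q hq =>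
    UniqueFactorizationMonoid.irreducible_of_normalized_factor q hq
  have hmon : ∀ q ∈ s, q.Monic := fun q hq => by
    rw [← UniqueFactorizationMonoid.normalize_normalized_factor q hq]
    exact monic_normalize (hirr q hq).ne_zero
  have hprod : s.prod = g := by
    rw [UniqueFactorizationMonoid.prod_normalizedFactors_eq hg.ne_zero, hg.normalize_eq_self]
  have hdeg : g.natDegree = (s.map natDegree).sum := by
    conv_lhs => rw [← hprod]
    exact natDegree_multiset_prod_of_monic _ hmon
  have hinner : ∀ e ∈ Finset.Icc 1 g.natDegree, ∀ q ∈ (monicOfDegree k e).filter Irreducible,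
      (∑ l ∈ Finset.Icc 1 g.natDegree, if q ^ l ∣ g then e else 0) = s.count q * q.natDegree := by
    intro e he q hq
    rw [Finset.mem_filter, mem_monicOfDegree] at hq
    rw [← Finset.sum_filter, Finset.sum_const, smul_eq_mul, hq.1.2]
    congr 1
    have : (Finset.Icc 1 g.natDegree).filter (fun l => q ^ l ∣ g) = Finset.Icc 1 (s.count q) := by
      ext l
      rw [Finset.mem_filter, Finset.mem_Icc, Finset.mem_Icc, pow_dvd_iff_le_emultiplicity,
        UniqueFactorizationMonoid.emultiplicity_eq_count_normalizedFactors hq.2 hg.ne_zero,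
        hq.1.1.normalize_eq_self, Nat.cast_le]
      refine ⟨fun h => ⟨h.1.1, h.2⟩, fun h => ⟨⟨h.1, ?_⟩, h.2⟩⟩
      have hdvd : q ^ l ∣ g := by
        rw [pow_dvd_iff_le_emultiplicity,
          UniqueFactorizationMonoid.emultiplicity_eq_count_normalizedFactors hq.2 hg.ne_zero,
          hq.1.1.normalize_eq_self, Nat.cast_le]
        exact h.2
      have := natDegree_le_of_dvd hdvd hg.ne_zero
      rw [natDegree_pow] at this
      have := hq.2.natDegree_pos
      nlinarith
    rw [this, Nat.card_Icc, Nat.add_sub_cancel]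
  rw [Finset.sum_congr rfl fun e he => Finset.sum_congr rfl fun q hq => hinner e he q hq]
  have hdisj : ((Finset.Icc 1 g.natDegree : Finset ℕ) : Set ℕ).PairwiseDisjoint
      fun e => (monicOfDegree k e).filter Irreducible := by
    intro e _ e' _ hee
    refine Finset.disjoint_left.2 fun q hq hq' => hee ?_
    rw [Finset.mem_filter, mem_monicOfDegree] at hq hq'
    exact hq.1.2.symm.trans hq'.1.2
  rw [← Finset.sum_biUnion hdisj, hdeg, Finset.sum_multiset_map_count]
  refine Finset.sum_subset ?_ ?_
  · intro q hq
    rw [Multiset.mem_toFinset] at hq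
    simp only [Finset.mem_biUnion, Finset.mem_filter, Finset.mem_Icc, mem_monicOfDegree]
    refine ⟨q.natDegree, ⟨(hirr q hq).natDegree_pos, ?_⟩, ⟨hmon q hq, rfl⟩, hirr q hq⟩
    rw [← Finset.sum_multiset_map_count, ← hdeg]
    exact natDegree_le_of_dvd (UniqueFactorizationMonoid.dvd_of_mem_normalizedFactors hq)
      hg.ne_zero
  · intro q _ hq
    rw [Multiset.mem_toFinset] at hq
    rw [Multiset.count_eq_zero_of_notMem hq, zero_smul]

/-- The sum of a function on polynomials over the monic polynomials of degree `m`. -/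
noncomputable def monicSum {k : Type*} [Field k] [Finite k] (lam : k[X] → ℂ) (m : ℕ) : ℂ :=
  ∑ g ∈ monicOfDegree k m, lam g

open Classical in
/-- The coefficients of the logarithmic derivative of the Euler product attached to a completely
multiplicative function on monic polynomials. -/
noncomputable def primePowerSum {k : Type*} [Field k] [Finite k] (lam : k[X] → ℂ) (r : ℕ) : ℂ :=
  ∑ x ∈ r.divisorsAntidiagonal, ∑ q ∈ (monicOfDegree k x.1).filter Irreducible,
    x.1 * lam q ^ x.2

open Classical in
theorem sum_monicOfDegree_of_dvd {k : Type*} [Field k] [Finite k] {lam : k[X] → ℂ}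
    (hmul : ∀ g h : k[X], g.Monic → h.Monic → lam (g * h) = lam g * lam h) {q : k[X]}
    (hq : q.Monic) {m : ℕ} (hm : q.natDegree ≤ m) :
    (∑ g ∈ monicOfDegree k m, if q ∣ g then lam g else 0) =
      lam q * monicSum lam (m - q.natDegree) := by
  rw [← Finset.sum_filter, monicSum, Finset.mul_sum]
  symm
  refine Finset.sum_bij (fun h _ => q * h) ?_ ?_ ?_ ?_
  · intro h hh
    rw [mem_monicOfDegree] at hh
    rw [Finset.mem_filter, mem_monicOfDegree, hq.natDegree_mul hh.1]
    exact ⟨⟨hq.mul hh.1, by lia⟩, dvd_mul_right _ _⟩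
  · intro a _ b _ hab
    exact mul_left_cancel₀ hq.ne_zero hab
  · intro g hg
    rw [Finset.mem_filter, mem_monicOfDegree] at hg
    obtain ⟨⟨hg, hgm⟩, h, rfl⟩ := hg
    have hh := hq.of_mul_monic_left hg
    refine ⟨h, mem_monicOfDegree.2 ⟨hh, ?_⟩, rfl⟩
    rw [hq.natDegree_mul hh] at hgm
    lia
  · intro h hh
    rw [hmul _ _ hq (mem_monicOfDegree.1 hh).1]

theorem mul_monicSum {k : Type*} [Field k] [Finite k] {lam : k[X] → ℂ} (hone : lam 1 = 1)
    (hmul : ∀ g h : k[X], g.Monic → h.Monic → lam (g * h) = lam g * lam h) (m : ℕ) :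
    m * monicSum lam m =
      ∑ r ∈ Finset.Icc 1 m, primePowerSum lam r * monicSum lam (m - r) := by
  classical
  have hpow : ∀ (q : k[X]), q.Monic → ∀ l : ℕ, lam (q ^ l) = lam q ^ l := by
    intro q hq l
    induction l with
    | zero => simp [hone]
    | succ l ih => rw [pow_succ, hmul _ _ (hq.pow l) hq, ih, pow_succ]
  let F : ℕ × ℕ → ℂ := fun x => ∑ q ∈ (monicOfDegree k x.1).filter Irreducible,
    x.1 * lam q ^ x.2 * monicSum lam (m - x.1 * x.2)
  have h1 : m * monicSum lam m = ∑ e ∈ Finset.Icc 1 m, ∑ l ∈ Finset.Icc 1 m,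
      if e * l ≤ m then F (e, l) else 0 := by
    calc m * monicSum lam m = ∑ g ∈ monicOfDegree k m, ∑ e ∈ Finset.Icc 1 m,
          ∑ q ∈ (monicOfDegree k e).filter Irreducible, ∑ l ∈ Finset.Icc 1 m,
            e * (if q ^ l ∣ g then lam g else 0) := by
          rw [monicSum, Finset.mul_sum]
          refine Finset.sum_congr rfl fun g hg => ?_
          rw [mem_monicOfDegree] at hg
          have := natDegree_eq_sum_irreducible hg.1
          rw [hg.2] at this
          conv_lhs => rw [this]
          push_cast
          simp only [Finset.sum_mul]
          refine Finset.sum_congr rfl fun e _ => Finset.sum_congr rfl fun q _ =>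
            Finset.sum_congr rfl fun l _ => ?_
          split_ifs <;> simp
      _ = ∑ e ∈ Finset.Icc 1 m, ∑ q ∈ (monicOfDegree k e).filter Irreducible,
            ∑ l ∈ Finset.Icc 1 m, ∑ g ∈ monicOfDegree k m,
            e * (if q ^ l ∣ g then lam g else 0) := by
          rw [Finset.sum_comm]
          refine Finset.sum_congr rfl fun e _ => ?_
          rw [Finset.sum_comm]
          refine Finset.sum_congr rfl fun q _ => ?_
          rw [Finset.sum_comm]
      _ = _ := by
          refine Finset.sum_congr rfl fun e _ => ?_
          rw [Finset.sum_comm]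
          refine Finset.sum_congr rfl fun l _ => ?_
          have hd : ∀ q ∈ (monicOfDegree k e).filter Irreducible, q.Monic ∧
              (q ^ l).natDegree = e * l := fun q hq => by
            rw [Finset.mem_filter, mem_monicOfDegree] at hq
            exact ⟨hq.1.1, by rw [hq.1.1.natDegree_pow, hq.1.2, mul_comm]⟩
          split_ifs with h
          · refine Finset.sum_congr rfl fun q hq => ?_
            obtain ⟨hqm, hqd⟩ := hd q hq
            rw [← Finset.mul_sum, sum_monicOfDegree_of_dvd hmul (hqm.pow l) (by rwa [hqd]),
              hpow q hqm, hqd]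
            ring
          · refine Finset.sum_eq_zero fun q hq => Finset.sum_eq_zero fun g hg => ?_
            obtain ⟨hqm, hqd⟩ := hd q hq
            rw [mem_monicOfDegree] at hg
            rw [if_neg, mul_zero]
            intro hdvd
            have := natDegree_le_of_dvd hdvd hg.1.ne_zero
            rw [hqd, hg.2] at this
            exact h this
  rw [h1, ← Finset.sum_product', ← Finset.sum_filter]
  have hmaps : ∀ x ∈ ((Finset.Icc 1 m) ×ˢ (Finset.Icc 1 m)).filter
      (fun x : ℕ × ℕ => x.1 * x.2 ≤ m), x.1 * x.2 ∈ Finset.Icc 1 m := by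
    intro x hx
    simp only [Finset.mem_filter, Finset.mem_product, Finset.mem_Icc] at hx ⊢
    exact ⟨Nat.mul_pos hx.1.1.1 hx.1.2.1, hx.2⟩
  rw [← Finset.sum_fiberwise_of_maps_to hmaps]
  refine Finset.sum_congr rfl fun r hr => ?_
  rw [primePowerSum, Finset.sum_mul]
  rw [Finset.mem_Icc] at hr
  refine Finset.sum_congr ?_ fun x hx => ?_
  · ext x
    simp only [Finset.mem_filter, Finset.mem_product, Finset.mem_Icc, Nat.mem_divisorsAntidiagonal]
    constructor
    · rintro ⟨-, rfl⟩
      exact ⟨rfl, by lia⟩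
    · rintro ⟨rfl, h⟩
      have h1 : 0 < x.1 := Nat.pos_of_ne_zero fun h0 => h (by rw [h0, zero_mul])
      have h2 : 0 < x.2 := Nat.pos_of_ne_zero fun h0 => h (by rw [h0, mul_zero])
      exact ⟨⟨⟨⟨h1, by nlinarith⟩, h2, by nlinarith⟩, hr.2⟩, rfl⟩
  · rw [Finset.sum_mul, (Nat.mem_divisorsAntidiagonal.1 hx).1.symm]

/-- The value `∑ₐ f a` over the roots `a` of the monic polynomial `g`, for `f` without constant
term. -/
noncomputable def sumRoots {k : Type*} [Field k] (f g : k[X]) : k :=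
  ∑ j ∈ Finset.range (f.natDegree + 1), f.coeff j * PowerSeries.coeff j (powerSumSeries g)

/-- The completely multiplicative function on monic polynomials attached to the mixed character
`x ↦ χ x * ψ (f x)`. -/
noncomputable def mixedCharacter {k : Type*} [Field k] (χ : MulChar k ℂ) (ψ : AddChar k ℂ)
    (f g : k[X]) : ℂ :=
  χ ((-1) ^ g.natDegree * g.coeff 0) * ψ (sumRoots f g)

theorem mixedCharacter_one {k : Type*} [Field k] (χ : MulChar k ℂ) (ψ : AddChar k ℂ) (f : k[X]) :
    mixedCharacter χ ψ f 1 = 1 := by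
  simp [mixedCharacter, sumRoots, powerSumSeries_one]

theorem mixedCharacter_mul {k : Type*} [Field k] (χ : MulChar k ℂ) (ψ : AddChar k ℂ) (f : k[X])
    (g h : k[X]) (hg : g.Monic) (hh : h.Monic) :
    mixedCharacter χ ψ f (g * h) = mixedCharacter χ ψ f g * mixedCharacter χ ψ f h := by
  have h1 : sumRoots f (g * h) = sumRoots f g + sumRoots f h := by
    simp only [sumRoots, powerSumSeries_mul hg hh, map_add, mul_add, Finset.sum_add_distrib]
  have h2 : (-1) ^ (g * h).natDegree * (g * h).coeff 0 =
      ((-1) ^ g.natDegree * g.coeff 0) * ((-1) ^ h.natDegree * h.coeff 0) := by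
    rw [hg.natDegree_mul hh, mul_coeff_zero]
    ring
  rw [mixedCharacter, h1, h2, map_mul, AddChar.map_add_eq_mul, mixedCharacter, mixedCharacter]
  ring

/-- A polynomial over the ground field splitting as the product of all conjugates of `x` is a power
of the minimal polynomial of `x`. -/
theorem exists_prod_conj_eq_map {k K : Type*} [Field k] [Field K] [Finite K] [Algebra k K]
    (x : K) : ∃ R : k[X], R.Monic ∧
      R.map (algebraMap k K) = ∏ σ : Gal(K/k), (X - C (σ x)) ∧
      R = minpoly k x ^ (Module.finrank k K / (minpoly k x).natDegree) := by
  classical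
  have : Finite k := Finite.of_injective _ (algebraMap k K).injective
  have : FiniteDimensional k K := inferInstance
  have hx : IsIntegral k x := Algebra.IsIntegral.isIntegral x
  obtain ⟨R, hR⟩ := (mem_lifts _).1
    (Algebra.IsInvariant.charpoly_mem_lifts k K Gal(K/k) x)
  replace hR : R.map (algebraMap k K) = ∏ σ : Gal(K/k), (X - C (σ x)) := hR
  have hRm : R.Monic := by
    apply monic_of_injective (algebraMap k K).injective
    rw [hR]
    exact monic_prod_of_monic _ _ fun σ _ => monic_X_sub_C _
  refine ⟨R, hRm, hR, ?_⟩
  have hdeg : R.natDegree = Module.finrank k K := by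
    rw [← natDegree_map (algebraMap k K), hR, natDegree_prod_of_monic _ _
      fun σ _ => monic_X_sub_C _]
    simp [IsGalois.card_aut_eq_finrank, ← Nat.card_eq_fintype_card]
  set s := UniqueFactorizationMonoid.normalizedFactors R
  have hs : ∀ q ∈ s, q = minpoly k x := by
    intro q hq
    have hqi := UniqueFactorizationMonoid.irreducible_of_normalized_factor q hq
    have hqm : q.Monic := by
      rw [← UniqueFactorizationMonoid.normalize_normalized_factor q hq]
      exact monic_normalize hqi.ne_zero
    have hdvd : q.map (algebraMap k K) ∣ ∏ σ : Gal(K/k), (X - C (σ x)) := by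
      rw [← hR]
      exact Polynomial.map_dvd (algebraMap k K) (UniqueFactorizationMonoid.dvd_of_mem_normalizedFactors hq)
    have hsplit : (q.map (algebraMap k K)).Splits :=
      Splits.of_dvd (Splits.prod fun σ _ => Splits.X_sub_C _)
        (Finset.prod_ne_zero_iff.2 fun σ _ => X_sub_C_ne_zero _) hdvd
    obtain ⟨y, hy⟩ := hsplit.exists_eval_eq_zero (by
      rw [degree_map]
      exact (degree_pos_of_irreducible hqi).ne')
    have hy' := eval_dvd hdvd (x := y)
    rw [hy, zero_dvd_iff, eval_prod, Finset.prod_eq_zero_iff] at hy'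
    obtain ⟨σ, -, hσ⟩ := hy'
    rw [eval_sub, eval_X, eval_C, sub_eq_zero] at hσ
    rw [minpoly.eq_of_irreducible_of_monic hqi (x := y) (by rwa [aeval_def, ← eval_map]) hqm, hσ]
    exact minpoly.algEquiv_eq σ x
  have hprod : s.prod = R := by
    rw [UniqueFactorizationMonoid.prod_normalizedFactors_eq hRm.ne_zero, hRm.normalize_eq_self]
  rw [Multiset.eq_replicate_of_mem hs, Multiset.prod_replicate] at hprod
  have : Module.finrank k K = s.card * (minpoly k x).natDegree := by
    rw [← hdeg, ← hprod, natDegree_pow]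
  rw [this, Nat.mul_div_cancel _ (minpoly.natDegree_pos hx), hprod]

theorem mixedCharacter_minpoly_pow {k K : Type*} [Field k] [Field K] [Finite K] [Algebra k K]
    (χ : MulChar k ℂ) (ψ : AddChar k ℂ) {f : k[X]} (hf : f.coeff 0 = 0) (x : K) :
    mixedCharacter χ ψ f (minpoly k x) ^ (Module.finrank k K / (minpoly k x).natDegree) =
      χ (Algebra.norm k x) * ψ (Algebra.trace k K (aeval x f)) := by
  classical
  have : Finite k := Finite.of_injective _ (algebraMap k K).injective
  have : FiniteDimensional k K := inferInstance
  have hx : IsIntegral k x := Algebra.IsIntegral.isIntegral x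
  obtain ⟨R, hRm, hR, hRq⟩ := exists_prod_conj_eq_map (k := k) x
  have hpow : ∀ l, mixedCharacter χ ψ f (minpoly k x ^ l) =
      mixedCharacter χ ψ f (minpoly k x) ^ l := by
    intro l
    induction l with
    | zero => simp [mixedCharacter_one]
    | succ l ih =>
      rw [pow_succ, mixedCharacter_mul _ _ _ _ _ ((minpoly.monic hx).pow l) (minpoly.monic hx), ih,
        pow_succ]
  rw [← hpow, ← hRq, mixedCharacter]
  have hnorm : (-1) ^ R.natDegree * R.coeff 0 = Algebra.norm k x := by
    apply (algebraMap k K).injective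
    rw [Algebra.norm_eq_prod_automorphisms, map_mul, map_pow, map_neg, map_one, ← coeff_map,
      ← natDegree_map (algebraMap k K), hR, coeff_zero_prod,
      natDegree_prod_of_monic _ _ fun σ _ => monic_X_sub_C _]
    simp [Finset.prod_neg, ← mul_assoc, ← mul_pow]
  have htrace : sumRoots f R = Algebra.trace k K (aeval x f) := by
    apply (algebraMap k K).injective
    have hs : R.map (algebraMap k K) =
        (((Finset.univ : Finset Gal(K/k)).val.map fun σ => σ x).map fun a => X - C a).prod := by
      rw [hR, Multiset.map_map]
      rfl
    rw [trace_eq_sum_automorphisms, sumRoots, map_sum]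
    simp_rw [aeval_eq_sum_range, map_sum, map_smul, map_pow]
    rw [Finset.sum_comm]
    refine Finset.sum_congr rfl fun j _ => ?_
    rcases eq_or_ne j 0 with rfl | hj
    · simp [hf]
    · rw [map_mul, ← coeff_powerSumSeries_map _ hRm, hs, coeff_powerSumSeries_prod _ hj,
        Multiset.map_map, ← Finset.smul_sum, Algebra.smul_def]
      rfl
  rw [hnorm, htrace]

open Classical in
theorem card_filter_minpoly_eq {k K : Type*} [Field k] [Field K] [Fintype K] [Algebra k K]
    {q : k[X]} (hq : Irreducible q) (hqm : q.Monic) (hdvd : q.natDegree ∣ Module.finrank k K) :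
    (Finset.univ.filter fun x : K => minpoly k x = q).card = q.natDegree := by
  have : Finite k := Finite.of_injective _ (algebraMap k K).injective
  have : Fintype k := Fintype.ofFinite k
  have : FiniteDimensional k K := inferInstance
  have hcard : Nat.card k ^ Module.finrank k K = Fintype.card K := by
    rw [Nat.card_eq_fintype_card, ← Module.card_eq_pow_finrank]
  have hd := (hq.natDegree_dvd_iff_dvd_X_pow_card_pow_sub_X).1 hdvd
  rw [hcard] at hd
  have hsplit : (q.map (algebraMap k K)).Splits := by
    refine Splits.of_dvd (FiniteField.isSplittingField_sub K k).splits ?_ (Polynomial.map_dvd (algebraMap k K) hd)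
    exact Polynomial.map_ne_zero (FiniteField.X_pow_card_sub_X_ne_zero k Fintype.one_lt_card)
  rw [← card_rootSet_eq_natDegree (K := K) (PerfectField.separable_of_irreducible hq) hsplit,
    Fintype.card_eq_nat_card, Nat.card_coe_set_eq, ← Set.ncard_coe_finset]
  congr 1
  ext x
  rw [mem_rootSet]
  simp
  constructor
  · rintro rfl
    exact ⟨hqm.ne_zero, minpoly.aeval _ _⟩
  · rintro ⟨-, h⟩
    exact (minpoly.eq_of_irreducible_of_monic hq h hqm).symm

theorem sum_norm_trace_eq_primePowerSum {k K : Type*} [Field k] [Finite k] [Field K] [Fintype K]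
    [Algebra k K] (χ : MulChar k ℂ) (ψ : AddChar k ℂ) {f : k[X]} (hf : f.coeff 0 = 0) :
    ∑ x : K, χ (Algebra.norm k x) * ψ (Algebra.trace k K (aeval x f)) =
      primePowerSum (mixedCharacter χ ψ f) (Module.finrank k K) := by
  classical
  have : FiniteDimensional k K := inferInstance
  have hr : Module.finrank k K ≠ 0 := Module.finrank_pos.ne'
  rw [primePowerSum, Nat.sum_divisorsAntidiagonal
    (fun e l => ∑ q ∈ (monicOfDegree k e).filter Irreducible, (e : ℂ) *
      mixedCharacter χ ψ f q ^ l)]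
  have hdisj : (((Module.finrank k K).divisors : Finset ℕ) : Set ℕ).PairwiseDisjoint
      fun e => (monicOfDegree k e).filter Irreducible := by
    intro e _ e' _ hee
    refine Finset.disjoint_left.2 fun q hq hq' => hee ?_
    rw [Finset.mem_filter, mem_monicOfDegree] at hq hq'
    exact hq.1.2.symm.trans hq'.1.2
  have hmaps : ∀ x ∈ (Finset.univ : Finset K), minpoly k x ∈
      (Module.finrank k K).divisors.biUnion fun e => (monicOfDegree k e).filter Irreducible := by
    intro x _
    have hx : IsIntegral k x := Algebra.IsIntegral.isIntegral x
    simp only [Finset.mem_biUnion, Nat.mem_divisors, Finset.mem_filter, mem_monicOfDegree]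
    exact ⟨_, ⟨minpoly.degree_dvd hx, hr⟩, ⟨minpoly.monic hx, rfl⟩, minpoly.irreducible hx⟩
  rw [← Finset.sum_fiberwise_of_maps_to hmaps, Finset.sum_biUnion hdisj]
  refine Finset.sum_congr rfl fun e he => Finset.sum_congr rfl fun q hq => ?_
  rw [Finset.mem_filter, mem_monicOfDegree] at hq
  obtain ⟨⟨hqm, rfl⟩, hqi⟩ := hq
  rw [Finset.sum_congr rfl (g := fun _ => mixedCharacter χ ψ f q ^
    (Module.finrank k K / q.natDegree)), Finset.sum_const, nsmul_eq_mul,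
    card_filter_minpoly_eq hqi hqm (Nat.dvd_of_mem_divisors he)]
  intro x hx
  rw [← (Finset.mem_filter.1 hx).2, mixedCharacter_minpoly_pow χ ψ hf]

theorem mixedCharacter_add {k : Type*} [Field k] (χ : MulChar k ℂ) (ψ : AddChar k ℂ) {f g : k[X]}
    (hf : 0 < f.natDegree) (hg : g.Monic) (hfg : f.natDegree < g.natDegree) (c : k) :
    mixedCharacter χ ψ f (g + C c * X ^ (g.natDegree - f.natDegree)) =
      mixedCharacter χ ψ f g * ψ (-(f.natDegree * f.leadingCoeff * c)) := by
  have hlt : (C c * X ^ (g.natDegree - f.natDegree)).degree < g.degree := by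
    refine (degree_C_mul_X_pow_le _ _).trans_lt ?_
    rw [degree_eq_natDegree hg.ne_zero]
    exact_mod_cast Nat.sub_lt_of_pos_le hf hfg.le
  have hdeg : (g + C c * X ^ (g.natDegree - f.natDegree)).natDegree = g.natDegree :=
    natDegree_eq_of_degree_eq (degree_add_eq_left_of_degree_lt hlt)
  have hcoeff : (g + C c * X ^ (g.natDegree - f.natDegree)).coeff 0 = g.coeff 0 := by
    rw [coeff_add, coeff_C_mul_X_pow, if_neg (by lia), add_zero]
  have hsum : sumRoots f (g + C c * X ^ (g.natDegree - f.natDegree)) =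
      sumRoots f g + -(f.natDegree * f.leadingCoeff * c) := by
    rw [sumRoots, Finset.sum_congr rfl fun j hj => by
      rw [coeff_powerSumSeries_add hg hf hfg.le c (Finset.mem_range_succ_iff.1 hj), mul_sub],
      Finset.sum_sub_distrib, sumRoots, sub_eq_add_neg]
    congr 2
    simp only [mul_ite, mul_zero]
    rw [Finset.sum_ite_eq' , if_pos (Finset.self_mem_range_succ _), leadingCoeff]
    ring
  rw [mixedCharacter, hdeg, hcoeff, hsum, AddChar.map_add_eq_mul, mixedCharacter]
  ring

theorem monicSum_mixedCharacter_eq_zero {k : Type*} [Field k] [Finite k] (χ : MulChar k ℂ)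
    {ψ : AddChar k ℂ} (hψ : ψ ≠ 1) {f : k[X]} (hf : (f.natDegree : k) ≠ 0) {m : ℕ}
    (hm : f.natDegree < m) : monicSum (mixedCharacter χ ψ f) m = 0 := by
  have hf0 : 0 < f.natDegree := Nat.pos_of_ne_zero fun h => hf (by rw [h, Nat.cast_zero])
  obtain ⟨a, ha⟩ := AddChar.ne_one_iff.1 hψ
  have hlc : (f.natDegree : k) * f.leadingCoeff ≠ 0 :=
    mul_ne_zero hf (leadingCoeff_ne_zero.2 fun h => by simp [h] at hf0)
  set c : k := -(a / (f.natDegree * f.leadingCoeff)) with hc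
  have hca : -(f.natDegree * f.leadingCoeff * c) = a := by
    rw [hc, mul_neg, neg_neg, mul_div_cancel₀ _ hlc]
  have hmem : ∀ (c : k), ∀ g ∈ monicOfDegree k m,
      g + C c * X ^ (m - f.natDegree) ∈ monicOfDegree k m := by
    intro c g hg
    rw [mem_monicOfDegree] at hg ⊢
    have hlt : (C c * X ^ (m - f.natDegree)).degree < g.degree := by
      refine (degree_C_mul_X_pow_le _ _).trans_lt ?_
      rw [degree_eq_natDegree hg.1.ne_zero, hg.2]
      exact_mod_cast Nat.sub_lt_of_pos_le hf0 hm.le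
    exact ⟨hg.1.add_of_left hlt,
      (natDegree_eq_of_degree_eq (degree_add_eq_left_of_degree_lt hlt)).trans hg.2⟩
  have key : monicSum (mixedCharacter χ ψ f) m = monicSum (mixedCharacter χ ψ f) m * ψ a := by
    conv_rhs => rw [monicSum, Finset.sum_mul]
    rw [monicSum]
    refine (Finset.sum_bij (fun g _ => g + C c * X ^ (m - f.natDegree)) (hmem c) ?_ ?_ ?_).symm
    · intro g _ h _ hgh
      exact add_right_cancel hgh
    · intro g hg
      refine ⟨g + C (-c) * X ^ (m - f.natDegree), hmem _ g hg, ?_⟩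
      rw [C_neg]
      ring
    · intro g hg
      rw [mem_monicOfDegree] at hg
      obtain ⟨hg, rfl⟩ := hg
      rw [mixedCharacter_add χ ψ hf0 hg hm, hca]
  have : monicSum (mixedCharacter χ ψ f) m * (1 - ψ a) = 0 := by linear_combination key
  exact (mul_eq_zero.1 this).resolve_right (sub_ne_zero.2 ha.symm)

/-- If the power series with coefficients `c` is a polynomial of degree at most `d` with constant
coefficient `1` then the coefficients of its logarithmic derivative are power sums. -/
theorem exists_multiset_pow_sum {c b : ℕ → ℂ} {d : ℕ} (hc0 : c 0 = 1) (hc : ∀ m, d < m → c m = 0)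
    (hb : ∀ m : ℕ, m * c m = ∑ r ∈ Finset.Icc 1 m, b r * c (m - r)) :
    ∃ s : Multiset ℂ, s.card = d ∧ ∀ r, r ≠ 0 → b r = -(s.map fun a => a ^ r).sum := by
  set P : ℂ[X] := ∑ i ∈ Finset.range (d + 1), C (c i) * X ^ (d - i) with hP
  have hPsum : P = X ^ d + ∑ i ∈ Finset.range d, C (c (i + 1)) * X ^ (d - (i + 1)) := by
    rw [hP, Finset.sum_range_succ', hc0, C_1, one_mul, Nat.sub_zero, add_comm]
  have hlt : (∑ i ∈ Finset.range d, C (c (i + 1)) * X ^ (d - (i + 1))).degree < (d : WithBot ℕ) := by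
    refine (degree_sum_le _ _).trans_lt ((Finset.sup_lt_iff (WithBot.bot_lt_coe d)).2 fun i hi => ?_)
    refine (degree_C_mul_X_pow_le _ _).trans_lt ?_
    rw [Finset.mem_range] at hi
    exact WithBot.coe_lt_coe.2 (by lia)
  have hPm : P.Monic := by
    rw [hPsum]
    exact monic_X_pow_add hlt
  have hPd : P.natDegree = d := by
    rw [hPsum]
    refine natDegree_eq_of_degree_eq_some ?_
    rw [degree_add_eq_left_of_degree_lt (by rwa [degree_X_pow]), degree_X_pow]
  have hrev : (P.reverse : PowerSeries ℂ) = PowerSeries.mk c := by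
    ext m
    rw [Polynomial.coeff_coe, PowerSeries.coeff_mk, coeff_reverse, hPd, hP, finsetSum_coeff]
    simp only [coeff_C_mul_X_pow]
    rcases le_or_gt m d with hm | hm
    · rw [revAt_le hm, Finset.sum_eq_single m]
      · simp
      · intro i hi him
        rw [Finset.mem_range] at hi
        rw [if_neg (by lia)]
      · intro h
        exact absurd (Finset.mem_range.2 (by lia)) h
    · rw [revAt_eq_self_of_lt hm, hc m hm]
      refine Finset.sum_eq_zero fun i hi => if_neg ?_
      lia
  have hser : PowerSeries.mk (fun r => if r = 0 then 0 else -b r) = powerSumSeries P := by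
    rw [powerSumSeries_eq_iff hPm, hrev]
    ext m
    rw [PowerSeries.coeff_mul, Finset.Nat.sum_antidiagonal_eq_sum_range_succ_mk]
    simp only [PowerSeries.coeff_mk]
    have h1 : ∑ r ∈ Finset.range m.succ, (if r = 0 then 0 else -b r) * c (m - r) =
        -(m * c m) := by
      rw [hb, Finset.range_eq_Ico, Finset.sum_eq_sum_Ico_succ_bot (by lia), if_pos rfl, zero_mul,
        zero_add, ← Finset.sum_neg_distrib]
      refine Finset.sum_congr rfl fun r hr => ?_
      rw [Finset.mem_Icc] at hr
      rw [if_neg (by lia), neg_mul]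
    rw [h1, map_neg]
    congr 1
    rcases m with _ | m
    · simp
    · rw [PowerSeries.coeff_succ_X_mul, PowerSeries.coeff_derivative, PowerSeries.coeff_mk,
        mul_comm, Nat.cast_succ]
  have hsplit : P.Splits := IsAlgClosed.splits P
  refine ⟨P.roots, by rw [← hsplit.natDegree_eq_card_roots, hPd], fun r hr => ?_⟩
  have h2 : P = (P.roots.map fun a => X - C a).prod := by
    conv_lhs => rw [hsplit.eq_prod_roots_of_monic hPm]
  rw [← coeff_powerSumSeries_prod _ hr, ← h2, ← hser, PowerSeries.coeff_mk, if_neg hr, neg_neg]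

/-- The exponential sums over all finite extensions of `k` attached to a mixed character are
power sums of `natDegree f` complex numbers. -/
theorem exists_multiset_sum_norm_trace {k : Type*} [Field k] [Finite k] (χ : MulChar k ℂ)
    {ψ : AddChar k ℂ} (hψ : ψ ≠ 1) {f : k[X]} (hf0 : f.coeff 0 = 0) (hf : (f.natDegree : k) ≠ 0) :
    ∃ s : Multiset ℂ, s.card = f.natDegree ∧ ∀ (K : Type) [Field K] [Fintype K] [Algebra k K],
      ∑ x : K, χ (Algebra.norm k x) * ψ (Algebra.trace k K (aeval x f)) =
        -(s.map fun a => a ^ Module.finrank k K).sum := by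
  have hc0 : monicSum (mixedCharacter χ ψ f) 0 = 1 := by
    have : monicOfDegree k 0 = {1} := by
      ext g
      rw [mem_monicOfDegree, Finset.mem_singleton]
      exact ⟨fun h => h.1.natDegree_eq_zero.1 h.2, fun h => by simp [h]⟩
    rw [monicSum, this, Finset.sum_singleton, mixedCharacter_one]
  obtain ⟨s, hs, hsum⟩ := exists_multiset_pow_sum hc0
    (fun m hm => monicSum_mixedCharacter_eq_zero χ hψ hf hm)
    (mul_monicSum (mixedCharacter_one χ ψ f) (mixedCharacter_mul χ ψ f))
  refine ⟨s, hs, fun K _ _ _ => ?_⟩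
  rw [sum_norm_trace_eq_primePowerSum χ ψ hf0, hsum _ Module.finrank_pos.ne']

/-- Dirichlet's simultaneous approximation: there are arbitrarily large `n` for which all the `n`-th
powers of a finite family of complex numbers are close to the positive real axis. -/
theorem frequently_half_norm_pow_le_re (s : Finset ℂ) :
    ∃ᶠ n : ℕ in atTop, ∀ a ∈ s, ‖a‖ ^ n / 2 ≤ (a ^ n).re := by
  let U : ℂ → Circle := fun a => Circle.exp a.arg
  have hU : MapClusterPt (1 : ℂ → Circle) atTop (U ^ · : ℕ → ℂ → Circle) :=
    mapClusterPt_one_atTop_pow U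
  have hnhds : {V : ℂ → Circle | ∀ a ∈ s, (1 / 2 : ℝ) < (V a : ℂ).re} ∈ 𝓝 (1 : ℂ → Circle) := by
    refine IsOpen.mem_nhds ?_ ?_
    · simp only [Set.ofPred_forall]
      refine isOpen_biInter_finset fun a _ => isOpen_lt continuous_const ?_
      fun_prop
    · intro a _
      simp
      norm_num
  refine (hU.frequently hnhds).mono fun n hn a ha => ?_
  have h1 := hn a ha
  have h2 : a ^ n = ((‖a‖ ^ n : ℝ) : ℂ) * ((U ^ n) a : ℂ) := by
    conv_lhs => rw [← Complex.norm_mul_exp_arg_mul_I a, mul_pow]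
    simp [U, Circle.coe_exp]
  rw [h2, Complex.re_ofReal_mul]
  nlinarith [pow_nonneg (norm_nonneg a) n]

theorem norm_le_of_norm_sum_pow_le {s : Multiset ℂ} {C B : ℝ} (hB : 0 < B)
    (h : ∀ᶠ n : ℕ in atTop, ‖(s.map fun a => a ^ n).sum‖ ≤ C * B ^ n) {a : ℂ} (ha : a ∈ s) :
    ‖a‖ ≤ B := by
  classical
  by_contra! hlt
  have hlim : Tendsto (fun n : ℕ => (‖a‖ / B) ^ n) atTop atTop :=
    tendsto_pow_atTop_atTop_of_one_lt ((one_lt_div hB).2 hlt)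
  obtain ⟨n, hn, hn1, hn2⟩ := ((frequently_half_norm_pow_le_re s.toFinset).and_eventually
    (h.and (hlim.eventually_gt_atTop (2 * C)))).exists
  rw [div_pow, lt_div_iff₀ (pow_pos hB n)] at hn2
  have hre : ‖a‖ ^ n / 2 ≤ ((s.map fun a => a ^ n).sum).re := by
    have h1 : ((s.map fun a => a ^ n).sum).re = (s.map fun a => (a ^ n).re).sum := by
      rw [← Complex.coe_reAddGroupHom, map_multiset_sum, Multiset.map_map]
      rfl
    rw [h1]
    refine (hn a (Multiset.mem_toFinset.2 ha)).trans ?_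
    refine Multiset.single_le_sum ?_ _ (Multiset.mem_map_of_mem (fun a => (a ^ n).re) ha)
    intro x hx
    obtain ⟨b, hb, rfl⟩ := Multiset.mem_map.1 hx
    exact le_trans (by positivity) (hn b (Multiset.mem_toFinset.2 hb))
  have := (Complex.re_le_norm _).trans hn1
  linarith

/-- The Weil bound for mixed character sums over a prime field. -/
theorem norm_sum_mulChar_mul_addChar_eval_le {p : ℕ} [Fact p.Prime] (χ : MulChar (ZMod p) ℂ)
    {ψ : AddChar (ZMod p) ℂ} (hψ : ψ ≠ 1) {f : (ZMod p)[X]} (hf0 : f.coeff 0 = 0)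
    (hf : ¬ p ∣ f.natDegree) :
    ‖∑ x, χ x * ψ (f.eval x)‖ ≤ f.natDegree * √p := by
  have hp : p.Prime := Fact.out
  obtain ⟨s, hs, hsum⟩ := exists_multiset_sum_norm_trace χ hψ hf0
    (by rwa [Ne, CharP.cast_eq_zero_iff (ZMod p) p])
  set D := p * (f.natDegree * (p - 1)) with hD
  have hbound : ∀ᶠ t : ℕ in atTop,
      ‖((s.map fun a => a ^ 2).map fun a => a ^ t).sum‖ ≤ (2 * (D : ℝ) + 2) * (p : ℝ) ^ t := by
    have hlim : Tendsto (fun t : ℕ => p ^ t) atTop atTop :=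
      tendsto_pow_atTop_atTop_of_one_lt hp.one_lt
    filter_upwards [hlim.eventually_gt_atTop (D ^ 2 + 3 * D + 1), eventually_ne_atTop 0]
      with t ht ht0
    let K := GaloisField p (2 * t)
    let _ : Fintype K := Fintype.ofFinite K
    have ht' : 2 * t ≠ 0 := by lia
    have hK : Fintype.card K = (p ^ t) ^ 2 := by
      rw [Fintype.card_eq_nat_card, GaloisField.card p _ ht', ← pow_mul, mul_comm]
    have : CharP K p := charP_of_injective_algebraMap (algebraMap (ZMod p) K).injective p
    let Ψ : AddChar K ℂ := ψ.compAddMonoidHom (Algebra.trace (ZMod p) K).toAddMonoidHom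
    let η : K →* ℂ := χ.toMonoidHom.comp (Algebra.norm (ZMod p))
    have hΨ : Ψ ≠ 1 := by
      obtain ⟨a, ha⟩ := AddChar.ne_one_iff.1 hψ
      obtain ⟨b, rfl⟩ := Algebra.trace_surjective (ZMod p) K a
      exact AddChar.ne_one_iff.2 ⟨b, ha⟩
    have hΨp : ∀ z, Ψ (z ^ p) = Ψ z := by
      intro z
      have h := Algebra.trace_eq_of_algEquiv
        (FiniteField.frobeniusAlgEquivOfAlgebraic (ZMod p) K) z
      rw [FiniteField.coe_frobeniusAlgEquivOfAlgebraic, ZMod.card] at h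
      exact congrArg ψ h
    have hη0 : η 0 = 0 := by
      change χ (Algebra.norm (ZMod p) (0 : K)) = 0
      rw [Algebra.norm_zero, MulChar.map_zero]
    have hη : ∀ y, y ≠ 0 → η y ^ (p - 1) = 1 := by
      intro y hy
      change χ (Algebra.norm (ZMod p) y) ^ (p - 1) = 1
      rw [← map_pow, ZMod.pow_card_sub_one_eq_one (Algebra.norm_ne_zero_iff.2 hy), map_one]
    have hdeg : (f.map (algebraMap (ZMod p) K)).natDegree = f.natDegree := natDegree_map _
    have h := norm_sum_mul_addChar_eval_le p t hK Ψ hΨ hΨp η hη0 hη (f.map (algebraMap (ZMod p) K))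
      (by rw [hdeg]; exact (hp.coprime_iff_not_dvd.2 hf).symm) (by rw [hdeg]; exact ht)
    have h1 : ∑ x, η x * Ψ ((f.map (algebraMap (ZMod p) K)).eval x) =
        -(s.map fun a => a ^ (2 * t)).sum := by
      have h2 := hsum K
      rw [GaloisField.finrank p ht'] at h2
      rw [← h2]
      refine Finset.sum_congr rfl fun x _ => ?_
      rw [eval_map_algebraMap]
      rfl
    rw [h1, norm_neg, hdeg] at h
    rw [Multiset.map_map]
    simp only [Function.comp_def, ← pow_mul]
    exact_mod_cast h
  have hroot : ∀ a ∈ s, ‖a‖ ≤ √p := by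
    intro a ha
    refine Real.le_sqrt_of_sq_le ?_
    rw [← norm_pow]
    exact norm_le_of_norm_sum_pow_le (by exact_mod_cast hp.pos) hbound
      (Multiset.mem_map_of_mem (fun a => a ^ 2) ha)
  have h1 := hsum (ZMod p)
  simp only [Algebra.norm_self, MonoidHom.id_apply, Algebra.trace_self_apply, Module.finrank_self, pow_one,
    Multiset.map_id', coe_aeval_eq_eval] at h1
  rw [h1, norm_neg]
  refine (norm_multiset_sum_le s).trans ?_
  rw [← hs, ← nsmul_eq_mul, ← Multiset.card_map (fun a => ‖a‖) s]
  refine Multiset.sum_le_card_nsmul _ _ fun x hx => ?_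
  obtain ⟨a, ha, rfl⟩ := Multiset.mem_map.1 hx
  exact hroot a ha

theorem sum_filter_pow_eq_one {F M : Type*} [Field F] [Fintype F] [DecidableEq F]
    [AddCommMonoid M] {n : ℕ} [NeZero n] {ζ : F} (hζ : IsPrimitiveRoot ζ n) (h : F → M) :
    ∑ x with x ^ n = 1, h x = ∑ l ∈ Finset.range n, h (ζ ^ l) := by
  symm
  refine Finset.sum_bij (fun l _ => ζ ^ l) ?_ ?_ ?_ fun _ _ => rfl
  · intro l _
    rw [Finset.mem_filter, ← pow_mul, mul_comm, pow_mul, hζ.pow_eq_one, one_pow]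
    exact ⟨Finset.mem_univ _, rfl⟩
  · intro i hi j hj hij
    exact hζ.pow_inj (Finset.mem_range.1 hi) (Finset.mem_range.1 hj) hij
  · intro x hx
    obtain ⟨i, hi, rfl⟩ := hζ.eq_pow_of_pow_eq_one (Finset.mem_filter.1 hx).2
    exact ⟨i, Finset.mem_range.2 hi, rfl⟩

theorem sum_range_mul_pow {F : Type*} [Field F] {n : ℕ} {ζ : F} (hζ : ζ ^ n = 1) (h : F → ℂ)
    (k : ℕ) : ∑ l ∈ Finset.range (n * k), h (ζ ^ l) = k * ∑ l ∈ Finset.range n, h (ζ ^ l) := by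
  induction k with
  | zero => simp
  | succ k ih =>
    rw [Nat.mul_succ, Finset.sum_range_add, ih]
    simp only [pow_add, pow_mul, hζ, one_pow, one_mul]
    push_cast
    ring

theorem exists_isPrimitiveRoot_card_sub_one (F : Type*) [Field F] [Fintype F] :
    ∃ g : F, IsPrimitiveRoot g (Fintype.card F - 1) := by
  classical
  obtain ⟨g, hg⟩ := IsCyclic.exists_generator (α := Fˣ)
  refine ⟨g, IsPrimitiveRoot.coe_units_iff.2 ?_⟩
  rw [← Fintype.card_units, ← Nat.card_eq_fintype_card, ← orderOf_eq_card_of_forall_mem_zpowers hg]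
  exact IsPrimitiveRoot.orderOf g

/-- A sum over the `n`-th roots of unity, expressed as a complete sum. -/
theorem sum_pow_primitiveRoot_eq {F : Type*} [Field F] [Fintype F] {n k : ℕ}
    (hnk : Fintype.card F = n * k + 1) (hk : k ≠ 0) {ζ : F} (hζ : IsPrimitiveRoot ζ n)
    {h : F → ℂ} (h0 : h 0 = 0) :
    ∑ x, h (x ^ k) = k * ∑ l ∈ Finset.range n, h (ζ ^ l) := by
  classical
  have hn : n ≠ 0 := by
    rintro rfl
    have := Fintype.one_lt_card (α := F)
    lia
  have : NeZero n := ⟨hn⟩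
  have : NeZero (n * k) := ⟨mul_ne_zero hn hk⟩
  obtain ⟨g, hg⟩ := exists_isPrimitiveRoot_card_sub_one F
  rw [hnk, Nat.add_sub_cancel] at hg
  have hζ' : IsPrimitiveRoot (g ^ k) n := hg.pow (Nat.pos_of_ne_zero (NeZero.ne _)) (mul_comm n k)
  have h1 : ∑ x, h (x ^ k) = ∑ x with x ^ (n * k) = 1, h (x ^ k) := by
    symm
    refine Finset.sum_subset (Finset.subset_univ _) fun x _ hx => ?_
    have : x = 0 := by
      by_contra hx0
      refine hx (Finset.mem_filter.2 ⟨Finset.mem_univ _, ?_⟩)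
      have := FiniteField.pow_card_sub_one_eq_one x hx0
      rwa [hnk, Nat.add_sub_cancel] at this
    rw [this, zero_pow hk, h0]
  rw [h1, sum_filter_pow_eq_one hg fun x => h (x ^ k), ← sum_filter_pow_eq_one hζ h,
    sum_filter_pow_eq_one hζ' h, ← sum_range_mul_pow hζ'.pow_eq_one]
  simp only [← pow_mul, mul_comm]

/-- The Weil bound for mixed character sums over the group of `n`-th roots of unity. -/
theorem norm_sum_primitiveRoot_le {p : ℕ} [Fact p.Prime] {n k d : ℕ} (hnk : p = n * k + 1)
    (hdk : d * k < p) {ζ : ZMod p} (hζ : IsPrimitiveRoot ζ n) (χ : MulChar (ZMod p) ℂ)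
    {ψ : AddChar (ZMod p) ℂ} (hψ : ψ ≠ 1) {c : Fin d → ZMod p} (hc : c ≠ 0) :
    ‖∑ l ∈ Finset.range n, ψ (∑ ν, c ν * (ζ ^ l) ^ ((ν : ℕ) + 1)) * χ (ζ ^ l)‖ ≤ d * √p := by
  have hp : p.Prime := Fact.out
  have hk : k ≠ 0 := by
    rintro rfl
    exact hp.one_lt.ne' (by simpa using hnk)
  set f : (ZMod p)[X] := ∑ ν : Fin d, C (c ν) * X ^ (k * ((ν : ℕ) + 1)) with hf
  have hcoeff : ∀ ν : Fin d, f.coeff (k * ((ν : ℕ) + 1)) = c ν := by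
    intro ν
    rw [hf, finsetSum_coeff, Finset.sum_eq_single ν]
    · simp
    · intro μ _ hμ
      rw [coeff_C_mul_X_pow, if_neg]
      intro h
      have := Nat.eq_of_mul_eq_mul_left (Nat.pos_of_ne_zero hk) h
      exact hμ (Fin.ext (by lia))
    · intro h
      exact absurd (Finset.mem_univ _) h
  have hf0 : f.coeff 0 = 0 := by
    rw [hf, finsetSum_coeff]
    refine Finset.sum_eq_zero fun ν _ => ?_
    rw [coeff_C_mul_X_pow, if_neg (mul_ne_zero hk (Nat.succ_ne_zero _)).symm]
  have hdeg : f.natDegree ≤ d * k := by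
    refine natDegree_sum_le_of_forall_le _ _ fun ν _ => (natDegree_C_mul_X_pow_le _ _).trans ?_
    rw [mul_comm]
    exact Nat.mul_le_mul_right _ ν.2
  have hdeg0 : f.natDegree ≠ 0 := by
    intro h
    have hfz : f = 0 := by rw [eq_C_of_natDegree_eq_zero h, hf0, C_0]
    refine hc (funext fun ν => ?_)
    rw [← hcoeff, hfz, coeff_zero, Pi.zero_apply]
  have hdvd : ¬ p ∣ f.natDegree := fun h =>
    absurd (Nat.le_of_dvd (Nat.pos_of_ne_zero hdeg0) h) (by lia)
  have hW := norm_sum_mulChar_mul_addChar_eval_le (χ ^ k) hψ hf0 hdvd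
  have hsum : ∑ x, (χ ^ k) x * ψ (f.eval x) =
      k * ∑ l ∈ Finset.range n, ψ (∑ ν, c ν * (ζ ^ l) ^ ((ν : ℕ) + 1)) * χ (ζ ^ l) := by
    rw [← sum_pow_primitiveRoot_eq (by rw [ZMod.card, hnk]) hk hζ
      (h := fun x => ψ (∑ ν, c ν * x ^ ((ν : ℕ) + 1)) * χ x) (by rw [MulChar.map_zero, mul_zero])]
    refine Finset.sum_congr rfl fun x _ => ?_
    rw [MulChar.pow_apply' _ hk, map_pow, mul_comm, hf, eval_finsetSum]
    simp [pow_mul]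
  rw [hsum, norm_mul, Complex.norm_natCast] at hW
  have hk0 : (0 : ℝ) < k := by exact_mod_cast Nat.pos_of_ne_zero hk
  refine le_of_mul_le_mul_left (hW.trans ?_) hk0
  calc (f.natDegree : ℝ) * √p ≤ (d * k : ℕ) * √p := by gcongr
    _ = k * (d * √p) := by push_cast; ring

theorem stdAddChar_ne_one (p : ℕ) [Fact p.Prime] : (ZMod.stdAddChar : AddChar (ZMod p) ℂ) ≠ 1 := by
  have := ZMod.isPrimitive_stdAddChar p one_ne_zero
  rwa [AddChar.mulShift_one] at this

end

theorem eZMod_eq_stdAddChar (m : ℕ) [NeZero m] (z : ZMod m) : eZMod m z = ZMod.stdAddChar z := by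
  rw [eZMod, ZMod.stdAddChar_apply, ZMod.toCircle_apply]

/-- The inner product of two vectors of the form
`n^{-1/2} (ψ (f u) χ(u)^i)_{u ∈ U_n}` as a character sum over the powers of a primitive root. -/
theorem inner_eq_sum_primitiveRoot {p n : ℕ} [Fact p.Prime] (hn : n ≠ 0) {ζ : ZMod p}
    (hζ : IsPrimitiveRoot ζ n) (χ : MulChar (ZMod p) ℂ) (F G : ZMod p → ZMod p) (i j : ℕ)
    {v w : EuclideanSpace ℂ {x : ZMod p // x ^ n = 1}}
    (hv : ∀ u, v u = (1 / Real.sqrt n : ℝ) * eZMod p (F u) * χ (u : ZMod p) ^ i)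
    (hw : ∀ u, w u = (1 / Real.sqrt n : ℝ) * eZMod p (G u) * χ (u : ZMod p) ^ j) :
    ⟪w, v⟫ = (n : ℂ)⁻¹ * ∑ l ∈ Finset.range n,
      ZMod.stdAddChar (F (ζ ^ l) - G (ζ ^ l)) * (χ (ζ ^ l) ^ i * χ⁻¹ (ζ ^ l) ^ j) := by
  have : NeZero n := ⟨hn⟩
  rw [PiLp.inner_apply, ← sum_filter_pow_eq_one hζ fun x =>
    (ZMod.stdAddChar (F x - G x) : ℂ) * (χ x ^ i * χ⁻¹ x ^ j), Finset.sum_subtype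
    (p := fun x : ZMod p => x ^ n = 1) _ (by simp), Finset.mul_sum]
  refine Finset.sum_congr rfl fun u _ => ?_
  have hsq : ((1 / Real.sqrt n : ℝ) : ℂ) * ((1 / Real.sqrt n : ℝ) : ℂ) = (n : ℂ)⁻¹ := by
    rw [← Complex.ofReal_mul, div_mul_div_comm, one_mul, Real.mul_self_sqrt n.cast_nonneg]
    simp
  have hstar : (starRingEnd ℂ) (χ (u : ZMod p)) = χ⁻¹ (u : ZMod p) := by
    rw [starRingEnd_apply, MulChar.star_apply']
  rw [hv, hw, RCLike.inner_apply, map_mul, map_mul, map_pow, hstar, Complex.conj_ofReal,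
    eZMod_eq_stdAddChar, eZMod_eq_stdAddChar, ← AddChar.map_neg_eq_conj, sub_eq_add_neg,
    AddChar.map_add_eq_mul, ← hsq]
  ring

theorem isPrimitiveRoot_mulChar {p n : ℕ} {ζ : ZMod p} (hζ : IsPrimitiveRoot ζ n)
    {χ : MulChar (ZMod p) ℂ}
    (hχ : ∀ x y : ZMod p, x ^ n = 1 → y ^ n = 1 → χ x = χ y → x = y) :
    IsPrimitiveRoot (χ ζ) n := by
  refine ⟨by rw [← map_pow, hζ.pow_eq_one, map_one], fun l hl => hζ.dvd_of_pow_eq_one l ?_⟩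
  refine hχ _ _ (by rw [← pow_mul, mul_comm, pow_mul, hζ.pow_eq_one, one_pow]) (one_pow n) ?_
  rw [map_pow, hl, map_one]

/-- Fix `d ≥ 1`.  Let `n ≥ 2`, let `p` be a prime with
`p ≡ 1 (mod n)`, let `U_n = {x ∈ F_p^× : x^n = 1}` and let `χ` be a
multiplicative character of `F_p` whose restriction to `U_n` has order `n`
(equivalently, is injective on `U_n`).  For a polynomial
`f(X) = Σ_{ν=1}^d a_ν X^ν` with `0 ≤ a_ν ≤ n−1` (encoded by `a : Fin d → Fin n`)
and `1 ≤ i ≤ n`, let `ψ_{f,i} = n^{-1/2}(e_p(f(u)) χ(u)^i)_{u ∈ U_n}`.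
Then: (i) each family `{ψ_{f,1}, …, ψ_{f,n}}` is an orthonormal basis of
`ℂ^{U_n}`; (ii) for distinct `f ≠ g` and `1 ≤ i, j ≤ n`,
`|⟨ψ_{g,j}, ψ_{f,i}⟩| ≤ d √p / n`. -/
theorem amub_special_dimensions
    (d : ℕ) (hd : 1 ≤ d) (n : ℕ) (hn : 2 ≤ n)
    (p : ℕ) [Fact p.Prime] (hpn : p % n = 1)
    (χ : MulChar (ZMod p) ℂ)
    (hχ : ∀ x y : ZMod p, x ^ n = 1 → y ^ n = 1 → χ x = χ y → x = y)
    (ψ : (Fin d → Fin n) → ℕ → EuclideanSpace ℂ {x : ZMod p // x ^ n = 1})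
    (hψ : ∀ a i (u : {x : ZMod p // x ^ n = 1}), ψ a i u =
      (1 / Real.sqrt n : ℝ) *
        eZMod p (∑ ν : Fin d, ((a ν : ℕ) : ZMod p) * (u : ZMod p) ^ ((ν : ℕ) + 1)) *
        χ (u : ZMod p) ^ i) :
    (∀ a, Orthonormal ℂ (fun i : Fin n => ψ a ((i : ℕ) + 1)) ∧
        Submodule.span ℂ (Set.range fun i : Fin n => ψ a ((i : ℕ) + 1)) = ⊤) ∧
    (∀ a b, a ≠ b → ∀ i j, 1 ≤ i → i ≤ n → 1 ≤ j → j ≤ n →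
        ‖⟪ψ b j, ψ a i⟫‖ ≤ (d : ℝ) * Real.sqrt p / n) := by
  have hp : p.Prime := Fact.out
  have hn0 : n ≠ 0 := by lia
  have : NeZero n := ⟨hn0⟩
  obtain ⟨k, hnk⟩ : ∃ k, p = n * k + 1 := ⟨p / n, by rw [← hpn, Nat.div_add_mod]⟩
  have hk : k ≠ 0 := by
    rintro rfl
    exact hp.one_lt.ne' (by simpa using hnk)
  obtain ⟨g, hg⟩ := exists_isPrimitiveRoot_card_sub_one (ZMod p)
  rw [ZMod.card, Nat.sub_eq_of_eq_add hnk] at hg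
  have hζ : IsPrimitiveRoot (g ^ k) n :=
    hg.pow (Nat.pos_of_ne_zero (mul_ne_zero hn0 hk)) (mul_comm n k)
  set ζ := g ^ k
  have hω := isPrimitiveRoot_mulChar hζ hχ
  have hζl : ∀ l, χ (ζ ^ l) = χ ζ ^ l := map_pow χ ζ
  have hω0 : χ ζ ≠ 0 := hω.ne_zero hn0
  have hζl' : ∀ l, χ⁻¹ (ζ ^ l) = (χ ζ)⁻¹ ^ l := by
    intro l
    rw [MulChar.inv_apply_eq_inv', hζl, inv_pow]
  have hnC : (n : ℂ) ≠ 0 := Nat.cast_ne_zero.2 hn0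
  have hcard : Fintype.card {x : ZMod p // x ^ n = 1} = n := by
    have := sum_filter_pow_eq_one hζ fun _ => (1 : ℕ)
    rw [Finset.sum_const, Finset.sum_const, Finset.card_range, smul_eq_mul, smul_eq_mul, mul_one,
      mul_one] at this
    rw [Fintype.card_subtype, this]
  let F : (Fin d → Fin n) → ZMod p → ZMod p := fun a x =>
    ∑ ν : Fin d, ((a ν : ℕ) : ZMod p) * x ^ ((ν : ℕ) + 1)
  have hinner : ∀ a b i j, ⟪ψ b j, ψ a i⟫ = (n : ℂ)⁻¹ * ∑ l ∈ Finset.range n,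
      ZMod.stdAddChar (F a (ζ ^ l) - F b (ζ ^ l)) * (χ (ζ ^ l) ^ i * χ⁻¹ (ζ ^ l) ^ j) :=
    fun a b i j => inner_eq_sum_primitiveRoot hn0 hζ χ (F a) (F b) i j (hψ a i) (hψ b j)
  refine ⟨fun a => ?_, fun a b hab i j hi _ hj _ => ?_⟩
  · have horth : Orthonormal ℂ fun i : Fin n => ψ a ((i : ℕ) + 1) := by
      rw [orthonormal_iff_ite]
      intro i j
      rw [hinner]
      simp only [sub_self, AddChar.map_zero_eq_one, one_mul, hζl, hζl']
      split_ifs with hij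
      · rw [hij]
        simp only [← mul_pow, ← pow_mul, mul_inv_cancel₀ hω0, one_pow]
        simp [hnC]
      · have hθ : χ ζ ^ ((j : ℕ) + 1) * (χ ζ)⁻¹ ^ ((i : ℕ) + 1) ≠ 1 := by
          intro h
          rw [inv_pow, mul_inv_eq_one₀ (pow_ne_zero _ hω0), pow_succ, pow_succ,
            mul_left_inj' hω0] at h
          exact hij (Fin.ext (hω.pow_inj i.2 j.2 h.symm))
        rw [Finset.sum_congr rfl fun l _ => by
          rw [← pow_mul, ← pow_mul, mul_comm l, mul_comm l, pow_mul, pow_mul, ← mul_pow],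
          geom_sum_eq hθ, mul_pow, ← pow_mul, ← pow_mul, mul_comm _ n, mul_comm _ n, pow_mul,
          pow_mul, inv_pow, hω.pow_eq_one]
        simp
    refine ⟨horth, horth.linearIndependent.span_eq_top_of_card_eq_finrank ?_⟩
    rw [Fintype.card_fin, finrank_euclideanSpace, hcard]
  · rw [hinner, norm_mul, norm_inv,
      Complex.norm_natCast, inv_mul_eq_div]
    refine div_le_div_of_nonneg_right ?_ n.cast_nonneg
    rcases le_or_gt (n : ℝ) (d * √p) with hle | hlt
    · refine (norm_sum_le_of_le _ (n := fun _ => (1 : ℝ)) fun l _ => ?_).trans (by simpa using hle)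
      rw [norm_mul, AddChar.norm_apply, one_mul, hζl, hζl', norm_mul]
      simp [Complex.norm_eq_one_of_pow_eq_one hω.pow_eq_one hn0]
    · have hp1 : (1 : ℝ) ≤ √p := Real.one_le_sqrt.2 (by exact_mod_cast hp.one_le)
      have hdn : (d : ℝ) < n := lt_of_le_of_lt (le_mul_of_one_le_right d.cast_nonneg hp1) hlt
      have hdk : d * k < p := by
        have : d < n := by exact_mod_cast hdn
        calc d * k ≤ n * k := Nat.mul_le_mul_right _ this.le
          _ < p := by lia
      have hc : (fun ν : Fin d => ((a ν : ℕ) : ZMod p) - ((b ν : ℕ) : ZMod p)) ≠ 0 := by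
        intro h
        refine hab (funext fun ν => Fin.ext ?_)
        have hν := congrFun h ν
        rw [Pi.zero_apply, sub_eq_zero, ZMod.natCast_eq_natCast_iff'] at hν
        have hnp : n < p := by
          rw [hnk]
          have := Nat.le_mul_of_pos_right n (Nat.pos_of_ne_zero hk)
          lia
        rwa [Nat.mod_eq_of_lt ((a ν).2.trans hnp), Nat.mod_eq_of_lt ((b ν).2.trans hnp)] at hν
      refine le_of_eq_of_le ?_
        (norm_sum_primitiveRoot_le hnk hdk hζ (χ ^ i * χ⁻¹ ^ j) (stdAddChar_ne_one p) hc)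
      congr 1
      refine Finset.sum_congr rfl fun l _ => ?_
      rw [MulChar.mul_apply, MulChar.pow_apply' _ (by lia), MulChar.pow_apply' _ (by lia)]
      simp only [F, ← Finset.sum_sub_distrib, ← sub_mul]
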